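/- arXiv:1409.0315 — 3 statements merged into one kernel-verified Lean document; each statement's English description precedes it below -/
import Mathlib

section
/- For every downward-triangulated binary cactus G with root r and every real ε with 0 < ε < π/2, there exists a straight-line drawing f of G that is an increasing-chord drawing and such that, for every block (triangular fan) μ of G with block root r(μ) and every vertex v of μ with v ≠ r(μ), the vector f(v) − f(r(μ)) forms an angle of at most ε/2 with the upward unit vector e₂ = (0,1). -/
open Real EuclideanGeometry
open scoped RealInnerProductSpace

noncomputable section

abbrev Pt : Type := EuclideanSpace ℝ (Fin 2)

/-- Vertex characterization of self-approaching polylines. -/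
def SelfApproachingPts (n : ℕ) (v : ℕ → Pt) : Prop :=
  ∀ i j : ℕ, i < j → j < n → 0 ≤ ⟪v (i + 1) - v i, v j - v (i + 1)⟫

/-- A polyline has increasing chords if both it and its reverse are self-approaching. -/
def IncreasingChordsPts (n : ℕ) (v : ℕ → Pt) : Prop :=
  SelfApproachingPts n v ∧ SelfApproachingPts n (fun i => v (n - 1 - i))

def IncreasingChordsList (l : List Pt) : Prop :=
  IncreasingChordsPts l.length (fun i => l.getD i 0)

/-- An increasing-chord straight-line drawing of a graph: an injective map of the
vertices into the plane such that any two distinct vertices are joined by a path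
whose image polyline has increasing chords. -/
def IsIncreasingChordDrawing {V : Type*} (G : SimpleGraph V) (f : V → Pt) : Prop :=
  Function.Injective f ∧ ∀ s t : V, s ≠ t →
    ∃ w : G.Walk s t, w.IsPath ∧ IncreasingChordsList (w.support.map f)

/-- Abstract structure of a downward-triangulated binary cactus (DTBC).
`leaf` stands for a bare fan vertex with no subcactus attached; `node k hk ch`
stands for a triangular fan with root `v₀` and fan vertices `v₁, …, v_k`
(`k ≥ 1`), where `v_i` is identified with the root of the structure `ch i`. -/
inductive DTBC : Type where
  | leaf : DTBC
  | node (k : ℕ) (hk : 1 ≤ k) (ch : Fin k → DTBC) : DTBC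

/-- Vertex set of a DTBC. `none` is the root of a node; `some ⟨i, v⟩` is a
vertex of the subcactus hanging at the `i`-th fan vertex. -/
def DTBC.Vert : DTBC → Type
  | .leaf => PUnit
  | .node k _ ch => Option (Σ i : Fin k, (ch i).Vert)

/-- The root vertex of a DTBC. -/
def DTBC.root : (g : DTBC) → g.Vert
  | .leaf => PUnit.unit
  | .node _ _ _ => none

/-- Adjacency of a DTBC: fan edges `v₀ v_i` (downward edges), fan edges
`v_i v_{i+1}`, and recursively the edges of the attached subcactuses. -/
def DTBC.adj : (g : DTBC) → g.Vert → g.Vert → Prop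
  | .leaf, _, _ => False
  | .node k _ ch, u, v =>
    match u, v with
    | none, none => False
    | none, some ⟨i, w⟩ => w = (ch i).root
    | some ⟨i, w⟩, none => w = (ch i).root
    | some ⟨i, u'⟩, some ⟨j, v'⟩ =>
        (∃ h : i = j, (ch j).adj (h ▸ u') v') ∨
        (((i : ℕ) + 1 = (j : ℕ) ∨ (j : ℕ) + 1 = (i : ℕ)) ∧
          u' = (ch i).root ∧ v' = (ch j).root)

/-- The graph of a DTBC. -/
def DTBC.graph (g : DTBC) : SimpleGraph g.Vert := SimpleGraph.fromRel g.adj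

/-- The upward unit vector `e₂ = (0, 1)`. -/
def e2 : Pt := EuclideanSpace.single (1 : Fin 2) (1 : ℝ)

/-- The angle condition on a drawing of a DTBC: for each block (triangular fan)
`μ` and each vertex `v ≠ r(μ)` of `μ`, the vector `f v - f (r μ)` forms an
angle of at most `ε` with the upward direction `e₂`. -/
def DTBC.AngleOK (ε : ℝ) : (g : DTBC) → (g.Vert → Pt) → Prop
  | .leaf, _ => True
  | .node k _ ch, f =>
      (∀ i : Fin k,
        InnerProductGeometry.angle (f (some ⟨i, (ch i).root⟩) - f none) e2 ≤ ε) ∧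
      (∀ i : Fin k, (ch i).AngleOK ε (fun v => f (some ⟨i, v⟩)))

open Filter Topology

def CK (u : Pt) (η : ℝ) (x : Pt) : Prop := ∃ c : ℝ, 0 ≤ c ∧ ‖x - c • u‖ ≤ c * η

lemma CK_zero (u : Pt) (η : ℝ) : CK u η 0 := ⟨0, le_rfl, by simp⟩

lemma CK_self (u : Pt) {η : ℝ} (h : 0 ≤ η) : CK u η u := ⟨1, zero_le_one, by simpa using h⟩

lemma CK_add {u : Pt} {η : ℝ} {x y : Pt} (hx : CK u η x) (hy : CK u η y) : CK u η (x + y) := by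
  obtain ⟨c, hc, hx⟩ := hx
  obtain ⟨d, hd, hy⟩ := hy
  refine ⟨c + d, by positivity, ?_⟩
  have : x + y - (c + d) • u = (x - c • u) + (y - d • u) := by module
  rw [this]
  have := norm_add_le (x - c • u) (y - d • u)
  linarith

lemma CK_mono {u u' : Pt} {η η' : ℝ} (h : ‖u' - u‖ + η' ≤ η) {x : Pt} (hx : CK u' η' x) :
    CK u η x := by
  obtain ⟨c, hc, hx⟩ := hx
  refine ⟨c, hc, ?_⟩
  have : x - c • u = (x - c • u') + c • (u' - u) := by module
  rw [this]
  have h1 := norm_add_le (x - c • u') (c • (u' - u))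
  rw [norm_smul, Real.norm_of_nonneg hc] at h1
  nlinarith

/-- A cone element has nonnegative inner product with `q` as soon as `u` does robustly. -/
lemma CK_inner {u : Pt} {η : ℝ} {x q : Pt} (hx : CK u η x) (h : η * ‖q‖ ≤ ⟪u, q⟫) :
    0 ≤ ⟪x, q⟫ := by
  obtain ⟨c, hc, hx⟩ := hx
  have : x = c • u + (x - c • u) := by module
  rw [this, inner_add_left, real_inner_smul_left]
  have h1 := abs_real_inner_le_norm (x - c • u) q
  have h2 := neg_abs_le ⟪x - c • u, q⟫
  have h3 : ‖x - c • u‖ * ‖q‖ ≤ c * η * ‖q‖ := by gcongr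
  nlinarith

lemma CK_inner_CK {u : Pt} {η : ℝ} (hη : 0 ≤ η) (h4 : 4 * η ≤ ‖u‖) {x y : Pt}
    (hx : CK u η x) (hy : CK u η y) : 0 ≤ ⟪x, y⟫ := by
  apply CK_inner hx
  obtain ⟨d, hd, hy⟩ := hy
  have e : y = d • u + (y - d • u) := by module
  have hn : ‖y‖ ≤ d * ‖u‖ + d * η := by
    calc ‖y‖ = ‖d • u + (y - d • u)‖ := by rw [← e]
      _ ≤ ‖d • u‖ + ‖y - d • u‖ := norm_add_le _ _
      _ ≤ _ := by rw [norm_smul, Real.norm_of_nonneg hd]; gcongr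
  have e2 : ⟪u, y⟫ = d * ‖u‖ ^ 2 + ⟪u, y - d • u⟫ := by
    rw [inner_sub_right, real_inner_smul_right, real_inner_self_eq_norm_sq]; ring
  have h1 := abs_real_inner_le_norm u (y - d • u)
  have h2 := neg_abs_le ⟪u, y - d • u⟫
  have h3 : ‖u‖ * ‖y - d • u‖ ≤ ‖u‖ * (d * η) := by gcongr
  have h5 : η * ‖y‖ ≤ η * (d * ‖u‖ + d * η) := by gcongr
  have h6 : 0 ≤ d * (‖u‖ ^ 2 - 2 * η * ‖u‖ - η ^ 2) := by
    apply mul_nonneg hd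
    nlinarith [norm_nonneg u]
  nlinarith

def rotJ (u : Pt) : Pt := !₂[-u 1, u 0]

lemma inner_rotJ (u : Pt) : ⟪u, rotJ u⟫ = 0 := by
  simp [rotJ, PiLp.inner_apply, Fin.sum_univ_two]; ring

lemma inner_rotJ' (u : Pt) : ⟪rotJ u, u⟫ = 0 := by
  rw [real_inner_comm, inner_rotJ]

lemma inner_rotJ_rotJ (u : Pt) : ⟪rotJ u, rotJ u⟫ = ⟪u, u⟫ := by
  rw [PiLp.inner_apply, PiLp.inner_apply]
  simp [rotJ, Fin.sum_univ_two]; ring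

lemma inner_comb (u : Pt) (a b c d : ℝ) :
    ⟪a • u + b • rotJ u, c • u + d • rotJ u⟫ = (a * c + b * d) * ⟪u, u⟫ := by
  simp only [inner_add_left, inner_add_right, real_inner_smul_left, real_inner_smul_right,
    inner_rotJ, inner_rotJ', inner_rotJ_rotJ]
  ring

lemma base_geom (k : ℕ) (u : Pt) (hu : u ≠ 0) (η ρ : ℝ) (hη : 0 < η) (hρ : 0 < ρ) :
    ∃ v y : Fin k → Pt, (∀ i, CK u η (v i) ∧ ‖v i‖ < ρ ∧ 0 < ⟪u, v i⟫) ∧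
      (∀ i, ‖y i - u‖ < η) ∧ (∀ i j, i ≠ j → 0 < ⟪y i, v i - v j⟫) ∧
      (∀ i j l, i < j → j < l → 0 < ⟪v j - v i, v l - v j⟫) := by
  have hU : 0 < ⟪u, u⟫ := real_inner_self_pos.2 hu
  let p : ℝ → Fin k → ℝ := fun h i => h * (i : ℕ)
  let w : ℝ → Fin k → Pt := fun h i => (1 - (p h i) ^ 2) • u + (p h i) • rotJ u
  let y : ℝ → Fin k → Pt := fun h i => (1 : ℝ) • u + (2 * p h i) • rotJ u
  have hpos : ∀ᶠ h : ℝ in 𝓝[>] 0, 0 < h := self_mem_nhdsWithin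
  have h1 : ∀ᶠ h : ℝ in 𝓝[>] 0, ∀ i, ‖w h i - u‖ < η := by
    refine eventually_all.2 fun i => nhdsWithin_le_nhds ?_
    have : ContinuousAt (fun h => ‖w h i - u‖) 0 := by
      simp only [w, p]; fun_prop
    exact this.eventually_lt continuousAt_const (by simpa [w, p] using hη)
  have h2 : ∀ᶠ h : ℝ in 𝓝[>] 0, ∀ i, ‖y h i - u‖ < η := by
    refine eventually_all.2 fun i => nhdsWithin_le_nhds ?_
    have : ContinuousAt (fun h => ‖y h i - u‖) 0 := by
      simp only [y, p]; fun_prop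
    exact this.eventually_lt continuousAt_const (by simpa [y, p] using hη)
  have h3 : ∀ᶠ h : ℝ in 𝓝[>] 0, ∀ i, (p h i) ^ 2 < 1 := by
    refine eventually_all.2 fun i => nhdsWithin_le_nhds ?_
    have : ContinuousAt (fun h => (p h i) ^ 2) 0 := by
      simp only [p]; fun_prop
    exact this.eventually_lt continuousAt_const (by simp [p])
  obtain ⟨h, hpos, h1, h2, h3⟩ := (hpos.and (h1.and (h2.and h3))).exists
  have h4 : ∀ᶠ s : ℝ in 𝓝[>] 0, ∀ i, ‖s • w h i‖ < ρ := by
    refine eventually_all.2 fun i => nhdsWithin_le_nhds ?_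
    have : ContinuousAt (fun s : ℝ => ‖s • w h i‖) 0 := by fun_prop
    exact this.eventually_lt continuousAt_const (by simpa using hρ)
  have hs : ∀ᶠ h : ℝ in 𝓝[>] 0, 0 < h := self_mem_nhdsWithin
  obtain ⟨s, hs, h4⟩ := (hs.and h4).exists
  have hp0 : ∀ i, 0 ≤ p h i := fun i => by positivity
  have hpm : ∀ i j, i < j → p h i < p h j := fun i j hij => by
    have : ((i : ℕ) : ℝ) < (j : ℕ) := by exact_mod_cast hij
    simp only [p]; gcongr
  have hd : ∀ i j, s • w h i - s • w h j =
      (s * ((p h j) ^ 2 - (p h i) ^ 2)) • u + (s * (p h i - p h j)) • rotJ u := by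
    intro i j; simp only [w]; module
  refine ⟨fun i => s • w h i, y h, fun i => ⟨⟨s, hs.le, ?_⟩, h4 i, ?_⟩, h2, ?_, ?_⟩
  · rw [← smul_sub, norm_smul, Real.norm_of_nonneg hs.le]
    have := (h1 i).le
    gcongr
  · simp only [w, inner_add_right, real_inner_smul_right, inner_rotJ]
    have := h3 i
    have : 0 < 1 - p h i ^ 2 := by linarith
    simp only [mul_zero, add_zero]
    positivity
  · intro i j hij
    simp only [hd]
    simp only [y, inner_comb]
    have : p h i - p h j ≠ 0 := by
      rcases lt_or_gt_of_ne hij with q | q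
      · have := hpm _ _ q; intro; linarith
      · have := hpm _ _ q; intro; linarith
    have e : (1 * (s * (p h j ^ 2 - p h i ^ 2)) + 2 * p h i * (s * (p h i - p h j))) =
      s * (p h i - p h j) ^ 2 := by ring
    rw [e]; positivity
  · intro i j l hij hjl
    simp only [hd, inner_comb]
    have a1 : 0 < p h j - p h i := by have := hpm _ _ hij; linarith
    have a2 : 0 < p h l - p h j := by have := hpm _ _ hjl; linarith
    have b1 := hp0 i
    have b2 := hp0 j
    have b3 := hp0 l
    have e : s * (p h i ^ 2 - p h j ^ 2) * (s * (p h j ^ 2 - p h l ^ 2)) +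
      s * (p h j - p h i) * (s * (p h l - p h j)) =
      s * s * (p h j - p h i) * (p h l - p h j) *
        (1 + (p h i + p h j) * (p h j + p h l)) := by ring
    rw [e]; positivity

lemma perturb (k : ℕ) (v y : Fin k → Pt) (u : Pt) (η ρ : ℝ) 
    (hv : ∀ i, ‖v i‖ < ρ) (hy : ∀ i, ‖y i - u‖ < η) (hy0 : ∀ i, y i ≠ 0)
    (ha : ∀ i j, i ≠ j → 0 < ⟪y i, v i - v j⟫)
    (hb : ∀ i j l, i < j → j < l → 0 < ⟪v j - v i, v l - v j⟫) :
    ∃ δ : ℝ, 0 < δ ∧ (∀ i, ‖v i‖ + δ < ρ) ∧ (∀ i, ‖y i - u‖ + δ ≤ η) ∧ (∀ i, 4 * δ ≤ ‖y i‖) ∧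
      (∀ i j, i ≠ j → ∀ z z', ‖z‖ < δ → ‖z'‖ < δ →
        δ * ‖(v i + z) - (v j + z')‖ < ⟪y i, (v i + z) - (v j + z')⟫) ∧
      (∀ i j l, i < j → j < l → ∀ z z' z'', ‖z‖ < δ → ‖z'‖ < δ → ‖z''‖ < δ →
        0 ≤ ⟪(v j + z') - (v i + z), (v l + z'') - (v j + z')⟫) := by
  have hpos : ∀ᶠ h : ℝ in 𝓝[>] 0, 0 < h := self_mem_nhdsWithin
  have key : ∀ F : ℝ → ℝ, Continuous F → 0 < F 0 → ∀ᶠ h : ℝ in 𝓝[>] 0, 0 < F h := by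
    intro F hF h0
    exact nhdsWithin_le_nhds (continuousAt_const.eventually_lt hF.continuousAt h0)
  have h1 : ∀ᶠ h : ℝ in 𝓝[>] 0, ∀ i, 0 < ρ - ‖v i‖ - h :=
    eventually_all.2 fun i => key _ (by fun_prop) (by have := hv i; simpa using this)
  have h2 : ∀ᶠ h : ℝ in 𝓝[>] 0, ∀ i, 0 < η - ‖y i - u‖ - h :=
    eventually_all.2 fun i => key _ (by fun_prop) (by have := hy i; simpa using this)
  have h3 : ∀ᶠ h : ℝ in 𝓝[>] 0, ∀ i, 0 < ‖y i‖ - 4 * h :=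
    eventually_all.2 fun i => key _ (by fun_prop) (by simpa using hy0 i)
  have h4 : ∀ᶠ h : ℝ in 𝓝[>] 0, ∀ i j, i ≠ j →
      0 < ⟪y i, v i - v j⟫ - ‖y i‖ * (2 * h) - h * (‖v i - v j‖ + 2 * h) := by
    refine eventually_all.2 fun i => eventually_all.2 fun j => eventually_imp_distrib_left.2 ?_
    intro hij
    exact key _ (by fun_prop) (by have := ha i j hij; simpa using this)
  have h5 : ∀ᶠ h : ℝ in 𝓝[>] 0, ∀ i j l, i < j → j < l →
      0 < ⟪v j - v i, v l - v j⟫ - ‖v j - v i‖ * (2 * h) - (2 * h) * (‖v l - v j‖ + 2 * h) := by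
    refine eventually_all.2 fun i => eventually_all.2 fun j => eventually_all.2 fun l =>
      eventually_imp_distrib_left.2 fun hij => eventually_imp_distrib_left.2 fun hjl => ?_
    exact key _ (by fun_prop) (by have := hb i j l hij hjl; simpa using this)
  obtain ⟨δ, hδ, h1, h2, h3, h4, h5⟩ :=
    (hpos.and (h1.and (h2.and (h3.and (h4.and h5))))).exists
  have hz : ∀ z z' : Pt, ‖z‖ < δ → ‖z'‖ < δ → ‖z - z'‖ ≤ 2 * δ := by
    intro z z' h h'
    have := norm_sub_le z z'
    linarith
  refine ⟨δ, hδ, fun i => by linarith [h1 i], fun i => by linarith [h2 i],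
    fun i => by linarith [h3 i], ?_, ?_⟩
  · intro i j hij z z' hz1 hz2
    have h0 := hz _ _ hz1 hz2
    have e : (v i + z) - (v j + z') = (v i - v j) + (z - z') := by abel
    rw [e, inner_add_right]
    have a1 := norm_add_le (v i - v j) (z - z')
    have a2 := abs_real_inner_le_norm (y i) (z - z')
    have a3 := neg_abs_le ⟪y i, z - z'⟫
    have a4 : ‖y i‖ * ‖z - z'‖ ≤ ‖y i‖ * (2 * δ) := by gcongr
    have a5 : δ * ‖v i - v j + (z - z')‖ ≤ δ * (‖v i - v j‖ + 2 * δ) := by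
      gcongr; linarith
    linarith [h4 i j hij]
  · intro i j l hij hjl z z' z'' hz1 hz2 hz3
    have h0 := hz _ _ hz2 hz1
    have h0' := hz _ _ hz3 hz2
    have e : (v j + z') - (v i + z) = (v j - v i) + (z' - z) := by abel
    have e' : (v l + z'') - (v j + z') = (v l - v j) + (z'' - z') := by abel
    rw [e, e', inner_add_left, inner_add_right]
    have b1 := norm_add_le (v l - v j) (z'' - z')
    have a2 := abs_real_inner_le_norm (v j - v i) (z'' - z')
    have a3 := neg_abs_le ⟪v j - v i, z'' - z'⟫
    have a4 : ‖v j - v i‖ * ‖z'' - z'‖ ≤ ‖v j - v i‖ * (2 * δ) := by gcongr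
    have c2 := abs_real_inner_le_norm (z' - z) (v l - v j + (z'' - z'))
    have c3 := neg_abs_le ⟪z' - z, v l - v j + (z'' - z')⟫
    have c4 : ‖z' - z‖ * ‖v l - v j + (z'' - z')‖ ≤ (2 * δ) * (‖v l - v j‖ + 2 * δ) := by
      gcongr; linarith
    linarith [h5 i j l hij hjl]

lemma CK_angle {θ : ℝ} (hθ : 0 < θ) :
    ∃ η : ℝ, 0 < η ∧ 4 * η ≤ ‖e2‖ ∧ ∀ x, CK e2 η x → x ≠ 0 →
      InnerProductGeometry.angle x e2 ≤ θ := by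
  have hn : ‖e2‖ = 1 := by simp [e2]
  have he : e2 ≠ 0 := by intro h; simp [h] at hn
  have hc : ContinuousAt (fun x : Pt => InnerProductGeometry.angle x e2) e2 :=
    (InnerProductGeometry.continuousAt_angle (x := (e2, e2)) he he).comp
      (f := fun x : Pt => (x, e2)) (by fun_prop)
  have h := hc.eventually_lt (g := fun _ => θ) continuousAt_const
    (by simpa [InnerProductGeometry.angle_self he] using hθ)
  obtain ⟨r, hr, h⟩ := Metric.eventually_nhds_iff.1 h
  refine ⟨min (r / 2) (1 / 4), by positivity, ?_, ?_⟩
  · rw [hn]; linarith [min_le_right (r / 2) (1 / 4)]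
  · rintro x ⟨c, hc, hx⟩ hx0
    rcases hc.eq_or_lt with rfl | hc
    · simp at hx; exact absurd hx hx0
    · have e : x = c • (c⁻¹ • x) := by rw [smul_smul, mul_inv_cancel₀ hc.ne', one_smul]
      rw [e, InnerProductGeometry.angle_smul_left_of_pos _ _ hc]
      apply le_of_lt
      apply h
      rw [dist_eq_norm]
      have e' : c⁻¹ • x - e2 = c⁻¹ • (x - c • e2) := by
        rw [smul_sub, smul_smul, inv_mul_cancel₀ hc.ne', one_smul]
      rw [e', norm_smul, Real.norm_of_nonneg (by positivity)]
      calc c⁻¹ * ‖x - c • e2‖ ≤ c⁻¹ * (c * min (r / 2) (1 / 4)) := by gcongr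
        _ = min (r / 2) (1 / 4) := by field_simp
        _ < r := by linarith [min_le_left (r / 2) (1 / 4)]

/-- The middle turn of the triple is by at most a right angle. -/
def Obt (a b c : Pt) : Prop := 0 ≤ ⟪b - a, c - b⟫

lemma Obt_symm {a b c : Pt} (h : Obt a b c) : Obt c b a := by
  unfold Obt at *
  rw [← neg_sub c b, ← neg_sub b a, inner_neg_neg, real_inner_comm]
  exact h

lemma triple_rev {l : List Pt} (h : l.Triplewise Obt) : l.reverse.Triplewise Obt :=
  List.triplewise_reverse.2 (h.imp Obt_symm)

lemma triple_SA {l : List Pt} (h : l.Triplewise Obt) :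
    SelfApproachingPts l.length (fun i => l.getD i 0) := by
  intro i j hij hj
  rcases (Nat.succ_le_of_lt hij).eq_or_lt with h1 | h1
  · subst h1
    simp
  · have := List.triplewise_iff_getElem.1 h i (i + 1) j (by omega) h1 hj
    simp only [List.getD_eq_getElem?_getD]
    rw [List.getElem?_eq_getElem hj, List.getElem?_eq_getElem (show i < l.length by omega),
      List.getElem?_eq_getElem (show i + 1 < l.length by omega)]
    exact this

lemma triple_IC {l : List Pt} (h : l.Triplewise Obt) : IncreasingChordsList l := by
  refine ⟨triple_SA h, ?_⟩
  have h2 := triple_SA (triple_rev h)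
  rw [List.length_reverse] at h2
  intro i j hij hj
  have := h2 i j hij hj
  have e : ∀ m, m < l.length → l.reverse.getD m 0 = l.getD (l.length - 1 - m) 0 := by
    intro m hm
    simp only [List.getD_eq_getElem?_getD]
    rw [List.getElem?_reverse hm]
  simp only at this
  rw [e _ (by omega), e _ (by omega), e _ hj] at this
  exact this

lemma triple_of_pairwise {α : Type*} {p : α → α → α → Prop} {R : α → α → Prop} {l : List α}
    (h : l.Pairwise R) (H : ∀ a b c, R a b → R b c → p a b c) : l.Triplewise p := by
  induction h with
  | nil => exact .nil
  | cons h1 h2 ih =>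
    exact .cons (h2.imp_of_mem fun ha _ hab => H _ _ _ (h1 _ ha) hab) ih

/-- Every downward edge vector satisfies `P`. -/
def EdgeOK (P : Pt → Prop) : (g : DTBC) → (g.Vert → Pt) → Prop
  | .leaf, _ => True
  | .node k _ ch, f =>
      (∀ i : Fin k, P (f (some ⟨i, (ch i).root⟩) - f none)) ∧
      (∀ i : Fin k, EdgeOK P (ch i) (fun v => f (some ⟨i, v⟩)))

lemma EdgeOK_mono {P Q : Pt → Prop} (h : ∀ x, P x → Q x) (w : Pt) (g : DTBC) :
    ∀ (f : g.Vert → Pt), EdgeOK P g f → EdgeOK Q g (fun v => w + f v) := by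
  induction g with
  | leaf => intro _ _; trivial
  | node k hk ch ih =>
    intro f hf
    refine ⟨fun i => ?_, fun i => ih i _ (hf.2 i)⟩
    have := h _ (hf.1 i)
    simpa using this

lemma EdgeOK_angle {P : Pt → Prop} {θ : ℝ}
    (h : ∀ x, P x → InnerProductGeometry.angle x e2 ≤ θ) (g : DTBC) :
    ∀ (f : g.Vert → Pt), EdgeOK P g f → g.AngleOK θ f := by
  induction g with
  | leaf => intro _ _; trivial
  | node k hk ch ih =>
    intro f hf
    exact ⟨fun i => h _ (hf.1 i), fun i => ih i _ (hf.2 i)⟩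

structure GoodDr (g : DTBC) (u : Pt) (η ρ : ℝ) (f : g.Vert → Pt) : Prop where
  root : f g.root = 0
  inj : Function.Injective f
  small : ∀ v, ‖f v‖ < ρ
  cone : ∀ v, CK u η (f v)
  edges : EdgeOK (fun x => CK u η x ∧ x ≠ 0) g f
  up : ∀ t, ∃ w : g.graph.Walk g.root t,
    w.support.Pairwise (fun a b => a ≠ b ∧ CK u η (f b - f a))
  pair : ∀ s t, ∃ w : g.graph.Walk s t, w.IsPath ∧ (w.support.map f).Triplewise Obt

section node
variable {k : ℕ} {hk : 1 ≤ k} {ch : Fin k → DTBC}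

/-- The vertex of the `i`-th child as a vertex of the node. -/
def inc (hk : 1 ≤ k) (ch : Fin k → DTBC) (i : Fin k) (v : (ch i).Vert) :
    (DTBC.node k hk ch).Vert := some ⟨i, v⟩

def rt (hk : 1 ≤ k) (ch : Fin k → DTBC) : (DTBC.node k hk ch).Vert := none

lemma inc_inj (i : Fin k) : Function.Injective (inc hk ch i) := by
  intro a b h
  have h' : (⟨i, a⟩ : Σ i : Fin k, (ch i).Vert) = ⟨i, b⟩ := Option.some.inj h
  simpa using h'

lemma inc_ne {i j : Fin k} (h : i ≠ j) (a : (ch i).Vert) (b : (ch j).Vert) :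
    inc hk ch i a ≠ inc hk ch j b := by
  intro h'
  have h' : (⟨i, a⟩ : Σ i : Fin k, (ch i).Vert) = ⟨j, b⟩ := Option.some.inj h'
  exact h (congrArg Sigma.fst h')

lemma rt_ne (i : Fin k) (a : (ch i).Vert) : rt hk ch ≠ inc hk ch i a := by
  intro h
  exact Option.some_ne_none _ h.symm

lemma vert_cases (v : (DTBC.node k hk ch).Vert) : v = rt hk ch ∨ ∃ i a, v = inc hk ch i a := by
  match v with
  | none => exact Or.inl rfl
  | some ⟨i, a⟩ => exact Or.inr ⟨i, a, rfl⟩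

lemma adj_rt (i : Fin k) : (DTBC.node k hk ch).graph.Adj (rt hk ch) (inc hk ch i (ch i).root) := by
  refine ⟨rt_ne _ _, Or.inl ?_⟩
  show (ch i).root = (ch i).root
  rfl

lemma adj_sib (i j : Fin k) (h : (i : ℕ) + 1 = j) :
    (DTBC.node k hk ch).graph.Adj (inc hk ch i (ch i).root) (inc hk ch j (ch j).root) := by
  refine ⟨inc_ne (by intro h'; subst h'; omega) _ _, Or.inl ?_⟩
  exact Or.inr ⟨Or.inl h, rfl, rfl⟩

def incHom (hk : 1 ≤ k) (ch : Fin k → DTBC) (i : Fin k) :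
    (ch i).graph →g (DTBC.node k hk ch).graph where
  toFun := inc hk ch i
  map_rel' := by
    rintro a b ⟨hne, h⟩
    refine ⟨fun h' => hne (inc_inj i h'), ?_⟩
    rcases h with h | h
    · exact Or.inl (Or.inl ⟨rfl, h⟩)
    · exact Or.inr (Or.inl ⟨rfl, h⟩)

def incWalk (hk : 1 ≤ k) (ch : Fin k → DTBC) (i : Fin k) {a b : (ch i).Vert}
    (w : (ch i).graph.Walk a b) :
    (DTBC.node k hk ch).graph.Walk (inc hk ch i a) (inc hk ch i b) := w.map (incHom hk ch i)

lemma support_incWalk (i : Fin k) {a b : (ch i).Vert} (w : (ch i).graph.Walk a b) :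
    (incWalk hk ch i w).support = w.support.map (inc hk ch i) :=
  SimpleGraph.Walk.support_map _ _

lemma isPath_incWalk (i : Fin k) {a b : (ch i).Vert} {w : (ch i).graph.Walk a b}
    (h : w.IsPath) : (incWalk hk ch i w).IsPath :=
  SimpleGraph.Walk.IsPath.map (f := incHom hk ch i) (inc_inj i) h

/-- Order relation along a path going down in child `i`, then right, then up in child `j`. -/
def RR (hk : 1 ≤ k) (ch : Fin k → DTBC) (fc : ∀ i, (ch i).Vert → Pt) (K : Fin k → Pt → Prop)
    (i j : Fin k) (a b : (DTBC.node k hk ch).Vert) : Prop :=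
  ∃ l x m y, a = inc hk ch l x ∧ b = inc hk ch m y ∧ i ≤ l ∧ m ≤ j ∧ a ≠ b ∧
    (l < m ∨ (l = m ∧ l = i ∧ ∃ x' y' : (ch i).Vert, a = inc hk ch i x' ∧ b = inc hk ch i y' ∧
        K i (fc i x' - fc i y')) ∨
      (l = m ∧ m = j ∧ ∃ x' y' : (ch j).Vert, a = inc hk ch j x' ∧ b = inc hk ch j y' ∧
        K j (fc j y' - fc j x')))

lemma chain_walk (fc : ∀ i, (ch i).Vert → Pt) (K : Fin k → Pt → Prop)
    (hup : ∀ i t, ∃ w : (ch i).graph.Walk (ch i).root t,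
      w.support.Pairwise (fun a b => a ≠ b ∧ K i (fc i b - fc i a)))
    (i j : Fin k) (hij : i < j) (t : (ch j).Vert) (d : ℕ) :
    ∀ l : Fin k, i ≤ l → (l : ℕ) + d = j →
    ∃ w : (DTBC.node k hk ch).graph.Walk (inc hk ch l (ch l).root) (inc hk ch j t),
      w.support.Pairwise (RR hk ch fc K i j) ∧
      ∀ a ∈ w.support, ∃ m x, a = inc hk ch m x ∧ l ≤ m ∧ m ≤ j := by
  induction d with
  | zero =>
    intro l _ hl
    have : l = j := Fin.ext (by simpa using hl)
    subst this
    obtain ⟨w, hw⟩ := hup l t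
    refine ⟨incWalk hk ch l w, ?_, ?_⟩
    · rw [support_incWalk, List.pairwise_map]
      refine hw.imp ?_
      rintro a b ⟨hne, hK⟩
      exact ⟨l, a, l, b, rfl, rfl, hij.le, le_rfl, fun h => hne (inc_inj l h),
        Or.inr (Or.inr ⟨rfl, rfl, a, b, rfl, rfl, hK⟩)⟩
    · intro a ha
      rw [support_incWalk, List.mem_map] at ha
      obtain ⟨x, _, rfl⟩ := ha
      exact ⟨l, x, rfl, le_rfl, le_rfl⟩
  | succ d ih =>
    intro l hil hl
    have hlt : (l : ℕ) + 1 < k := by have := j.2; omega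
    obtain ⟨w, hw1, hw2⟩ := ih ⟨l + 1, hlt⟩ (by
      rw [Fin.le_def] at *; simp only; omega) (by simp only; omega)
    refine ⟨SimpleGraph.Walk.cons (adj_sib l ⟨l + 1, hlt⟩ rfl) w, ?_, ?_⟩
    · rw [SimpleGraph.Walk.support_cons, List.pairwise_cons]
      refine ⟨fun b hb => ?_, hw1⟩
      obtain ⟨m, x, rfl, h1, h2⟩ := hw2 b hb
      have hlm : l < m := by rw [Fin.le_def] at h1; rw [Fin.lt_def]; simp only at h1; omega
      exact ⟨l, _, m, x, rfl, rfl, hil, h2, inc_ne hlm.ne _ _, Or.inl hlm⟩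
    · intro a ha
      rw [SimpleGraph.Walk.support_cons, List.mem_cons] at ha
      rcases ha with rfl | ha
      · exact ⟨l, _, rfl, le_rfl, by rw [Fin.le_def]; omega⟩
      · obtain ⟨m, x, rfl, h1, h2⟩ := hw2 a ha
        refine ⟨m, x, rfl, ?_, h2⟩
        rw [Fin.le_def] at *; simp only at h1; omega

lemma cross_walk (fc : ∀ i, (ch i).Vert → Pt) (K : Fin k → Pt → Prop)
    (hup : ∀ i t, ∃ w : (ch i).graph.Walk (ch i).root t,
      w.support.Pairwise (fun a b => a ≠ b ∧ K i (fc i b - fc i a)))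
    (i j : Fin k) (hij : i < j) (s : (ch i).Vert) (t : (ch j).Vert) :
    ∃ w : (DTBC.node k hk ch).graph.Walk (inc hk ch i s) (inc hk ch j t),
      w.support.Pairwise (RR hk ch fc K i j) := by
  have hlt : (i : ℕ) + 1 < k := by have := j.2; rw [Fin.lt_def] at hij; omega
  rw [Fin.lt_def] at hij
  obtain ⟨w, hw1, hw2⟩ := chain_walk (hk := hk) fc K hup i j hij t ((j : ℕ) - (i + 1))
    ⟨i + 1, hlt⟩ (by rw [Fin.le_def]; simp) (by simp only; omega)
  obtain ⟨q, hq⟩ := hup i s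
  refine ⟨(incWalk hk ch i q).reverse.append
    (SimpleGraph.Walk.cons (adj_sib i ⟨i + 1, hlt⟩ rfl) w), ?_⟩
  rw [SimpleGraph.Walk.support_append, SimpleGraph.Walk.support_cons, List.tail_cons,
    SimpleGraph.Walk.support_reverse, support_incWalk, List.pairwise_append]
  refine ⟨?_, hw1, ?_⟩
  · rw [List.pairwise_reverse, List.pairwise_map]
    refine hq.imp ?_
    rintro a b ⟨hne, hK⟩
    exact ⟨i, b, i, a, rfl, rfl, le_rfl, hij.le, fun h => hne (inc_inj i h).symm,
      Or.inr (Or.inl ⟨rfl, rfl, b, a, rfl, rfl, hK⟩)⟩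
  · intro a ha b hb
    rw [List.mem_reverse, List.mem_map] at ha
    obtain ⟨x, _, rfl⟩ := ha
    obtain ⟨m, y, rfl, h1, h2⟩ := hw2 b hb
    have him : i < m := by rw [Fin.le_def] at h1; rw [Fin.lt_def]; simp only at h1; omega
    exact ⟨i, x, m, y, rfl, rfl, le_rfl, h2, inc_ne him.ne _ _, Or.inl him⟩

/-- Combined drawing. -/
def comb (hk : 1 ≤ k) (ch : Fin k → DTBC) (v : Fin k → Pt) (fc : ∀ i, (ch i).Vert → Pt) :
    (DTBC.node k hk ch).Vert → Pt
  | none => 0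
  | some ⟨i, x⟩ => v i + fc i x

lemma comb_inc (v : Fin k → Pt) (fc : ∀ i, (ch i).Vert → Pt) (i : Fin k) (x : (ch i).Vert) :
    comb hk ch v fc (inc hk ch i x) = v i + fc i x := rfl

lemma comb_rt (v : Fin k → Pt) (fc : ∀ i, (ch i).Vert → Pt) :
    comb hk ch v fc (rt hk ch) = 0 := rfl

lemma node_good (u : Pt) (η ρ : ℝ) (hη : 0 < η) (hρ : 0 < ρ) (h4 : 4 * η ≤ ‖u‖)
    (ih : ∀ (i : Fin k) (u : Pt) (η ρ : ℝ), 0 < η → 0 < ρ → 4 * η ≤ ‖u‖ →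
      ∃ f, GoodDr (ch i) u η ρ f) :
    ∃ f, GoodDr (DTBC.node k hk ch) u η ρ f := by
  have hu : u ≠ 0 := by
    intro h; rw [h, norm_zero] at h4; linarith
  obtain ⟨v, y, hv, hy, ha, hb⟩ := base_geom k u hu η ρ hη hρ
  have hy0 : ∀ i, y i ≠ 0 := by
    intro i h
    have := hy i
    rw [h, zero_sub, norm_neg] at this
    linarith
  obtain ⟨δ, hδ, p1, p2, p3, p4, p5⟩ := perturb k v y u η ρ (fun i => (hv i).2.1) hy hy0 ha hb
  choose fc hfc using fun i => ih i (y i) δ δ hδ hδ (p3 i)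
  have hsub : ∀ i x, CK (y i) δ x → CK u η x := fun i x hx => CK_mono (p2 i) hx
  have hcone : ∀ i x, CK u η (v i + fc i x) := fun i x =>
    CK_add (hv i).1 (hsub i _ ((hfc i).cone x))
  have hpos : ∀ i x, v i + fc i x ≠ 0 := by
    intro i x h
    have h1 := CK_inner_CK hη.le h4 (CK_self u hη.le) (hsub i _ ((hfc i).cone x))
    have h2 := (hv i).2.2
    have h3 : ⟪u, v i + fc i x⟫ = 0 := by rw [h, inner_zero_right]
    rw [inner_add_right] at h3
    linarith
  have hsep : ∀ i j, i ≠ j → ∀ x x', ∀ z, CK (y i) δ z →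
      0 ≤ ⟪z, (v i + fc i x) - (v j + fc j x')⟫ := fun i j hij x x' z hz =>
    CK_inner hz (p4 i j hij _ _ ((hfc i).small x) ((hfc j).small x')).le
  have hup : ∀ i t, ∃ w : (ch i).graph.Walk (ch i).root t,
      w.support.Pairwise (fun a b => a ≠ b ∧ CK (y i) δ (fc i b - fc i a)) :=
    fun i => (hfc i).up
  have hupU : ∀ t, ∃ w : (DTBC.node k hk ch).graph.Walk (rt hk ch) t,
      w.support.Pairwise (fun a b => a ≠ b ∧
        CK u η (comb hk ch v fc b - comb hk ch v fc a)) := by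
    intro t
    rcases vert_cases t with rfl | ⟨i, t, rfl⟩
    · exact ⟨SimpleGraph.Walk.nil, by simp⟩
    · obtain ⟨w, hw⟩ := hup i t
      refine ⟨SimpleGraph.Walk.cons (adj_rt i) (incWalk hk ch i w), ?_⟩
      rw [SimpleGraph.Walk.support_cons, support_incWalk, List.pairwise_cons]
      constructor
      · intro b hb
        rw [List.mem_map] at hb
        obtain ⟨x, _, rfl⟩ := hb
        refine ⟨rt_ne _ _, ?_⟩
        show CK u η ((v i + fc i x) - 0)
        rw [sub_zero]
        exact hcone i x
      · rw [List.pairwise_map]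
        refine hw.imp ?_
        rintro a b ⟨hne, hK⟩
        refine ⟨fun h => hne (inc_inj i h), ?_⟩
        show CK u η ((v i + fc i b) - (v i + fc i a))
        rw [add_sub_add_left_eq_sub]
        exact hsub i _ hK
  have hsymm : ∀ s t, (∃ w : (DTBC.node k hk ch).graph.Walk s t, w.IsPath ∧
      (w.support.map (comb hk ch v fc)).Triplewise Obt) →
      ∃ w : (DTBC.node k hk ch).graph.Walk t s, w.IsPath ∧
      (w.support.map (comb hk ch v fc)).Triplewise Obt := by
    rintro s t ⟨w, h1, h2⟩
    refine ⟨w.reverse, h1.reverse, ?_⟩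
    rw [SimpleGraph.Walk.support_reverse, List.map_reverse]
    exact triple_rev h2
  have hroot : ∀ t, ∃ w : (DTBC.node k hk ch).graph.Walk (rt hk ch) t, w.IsPath ∧
      (w.support.map (comb hk ch v fc)).Triplewise Obt := by
    intro t
    obtain ⟨w, hw⟩ := hupU t
    refine ⟨w, (SimpleGraph.Walk.isPath_def _).2 (hw.imp fun h => h.1), ?_⟩
    rw [List.triplewise_map]
    exact triple_of_pairwise hw fun a b c h1 h2 => CK_inner_CK hη.le h4 h1.2 h2.2
  have hcross : ∀ i j, i < j → ∀ s t, ∃ w : (DTBC.node k hk ch).graph.Walk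
      (inc hk ch i s) (inc hk ch j t), w.IsPath ∧
      (w.support.map (comb hk ch v fc)).Triplewise Obt := by
    intro i j hij s t
    obtain ⟨w, hw⟩ := cross_walk (hk := hk) fc (fun i => CK (y i) δ) hup i j hij s t
    refine ⟨w, (SimpleGraph.Walk.isPath_def _).2 (hw.imp ?_), ?_⟩
    · rintro a b ⟨l, x, m, y, _, _, _, _, h, _⟩
      exact h
    rw [List.triplewise_map]
    refine triple_of_pairwise hw ?_
    rintro a b c ⟨l, x, m, x', rfl, rfl, hil, hmj, -, h1⟩ ⟨m', x₂, n, x'', hm, rfl, him, hnj, -, h2⟩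
    have hmm : m = m' := by
      by_contra hne
      exact inc_ne hne _ _ hm
    subst hmm
    have := inc_inj _ hm
    subst this
    rcases h1 with h1 | ⟨rfl, rfl, a', b', ea, eb, hK⟩ | ⟨rfl, rfl, a', b', ea, eb, hK⟩
    · rcases h2 with h2 | ⟨rfl, rfl, a', b', ea, eb, hK⟩ | ⟨rfl, rfl, a', b', ea, eb, hK⟩
      · exact p5 l m n h1 h2 _ _ _ ((hfc l).small x) ((hfc m).small x') ((hfc n).small x'')
      · exact absurd h1 (not_lt.2 hil)
      · obtain rfl := inc_inj _ ea
        obtain rfl := inc_inj _ eb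
        have := hsep m l h1.ne' x' x _ hK
        show 0 ≤ ⟪(v m + fc m x') - (v l + fc l x), (v m + fc m x'') - (v m + fc m x')⟫
        rw [add_sub_add_left_eq_sub (fc m x''), real_inner_comm]
        exact this
    · obtain rfl := inc_inj _ ea
      obtain rfl := inc_inj _ eb
      rcases h2 with h2 | ⟨rfl, _, a', b', ea, eb, hK2⟩ | ⟨rfl, rfl, a', b', ea, eb, hK2⟩
      · apply Obt_symm
        have := hsep l n h2.ne x' x'' _ hK
        show 0 ≤ ⟪(v l + fc l x') - (v n + fc n x''), (v l + fc l x) - (v l + fc l x')⟫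
        rw [add_sub_add_left_eq_sub (fc l x), real_inner_comm]
        exact this
      · obtain rfl := inc_inj _ ea
        obtain rfl := inc_inj _ eb
        apply Obt_symm
        show 0 ≤ ⟪(v l + fc l x') - (v l + fc l x''), (v l + fc l x) - (v l + fc l x')⟫
        rw [add_sub_add_left_eq_sub, add_sub_add_left_eq_sub]
        exact CK_inner_CK hδ.le (p3 l) hK2 hK
      · exact absurd hij (lt_irrefl _)
    · obtain rfl := inc_inj _ ea
      obtain rfl := inc_inj _ eb
      rcases h2 with h2 | ⟨rfl, rfl, a', b', ea, eb, hK2⟩ | ⟨rfl, _, a', b', ea, eb, hK2⟩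
      · exact absurd h2 (not_lt.2 hnj)
      · exact absurd hij (lt_irrefl _)
      · obtain rfl := inc_inj _ ea
        obtain rfl := inc_inj _ eb
        show 0 ≤ ⟪(v l + fc l x') - (v l + fc l x), (v l + fc l x'') - (v l + fc l x')⟫
        rw [add_sub_add_left_eq_sub, add_sub_add_left_eq_sub]
        exact CK_inner_CK hδ.le (p3 l) hK hK2
  refine ⟨comb hk ch v fc, ⟨rfl, ?_, ?_, ?_, ?_, hupU, ?_⟩⟩
  · intro a b hab
    rcases vert_cases a with rfl | ⟨i, a, rfl⟩
    · rcases vert_cases b with rfl | ⟨j, b, rfl⟩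
      · rfl
      · exact absurd hab.symm (hpos j b)
    · rcases vert_cases b with rfl | ⟨j, b, rfl⟩
      · exact absurd hab (hpos i a)
      · rw [comb_inc, comb_inc] at hab
        by_cases hij : i = j
        · subst hij
          rw [(hfc i).inj (add_left_cancel hab)]
        · have := p4 i j hij _ _ ((hfc i).small a) ((hfc j).small b)
          rw [hab, sub_self, norm_zero, inner_zero_right, mul_zero] at this
          exact absurd this (lt_irrefl _)
  · intro a
    rcases vert_cases a with rfl | ⟨i, a, rfl⟩
    · rw [comb_rt, norm_zero]; exact hρ
    · rw [comb_inc]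
      have := norm_add_le (v i) (fc i a)
      have := (hfc i).small a
      linarith [p1 i]
  · intro a
    rcases vert_cases a with rfl | ⟨i, a, rfl⟩
    · exact CK_zero u η
    · exact hcone i a
  · refine ⟨fun i => ?_, fun i => ?_⟩
    · have h1 := hcone i (ch i).root
      have h2 := hpos i (ch i).root
      show CK u η ((v i + fc i (ch i).root) - 0) ∧ (v i + fc i (ch i).root) - 0 ≠ 0
      rw [sub_zero]
      exact ⟨h1, h2⟩
    · exact EdgeOK_mono (fun x hx => ⟨hsub i x hx.1, hx.2⟩) (v i) (ch i) _ (hfc i).edges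
  · intro s t
    rcases vert_cases s with rfl | ⟨i, s, rfl⟩
    · exact hroot t
    · rcases vert_cases t with rfl | ⟨j, t, rfl⟩
      · exact hsymm _ _ (hroot _)
      · rcases lt_trichotomy i j with hij | rfl | hij
        · exact hcross i j hij s t
        · obtain ⟨w, h1, h2⟩ := (hfc i).pair s t
          refine ⟨incWalk hk ch i w,
            isPath_incWalk i h1, ?_⟩
          rw [support_incWalk, List.map_map, List.triplewise_map]
          rw [List.triplewise_map] at h2
          refine h2.imp ?_
          intro a b c h
          show 0 ≤ ⟪(v i + fc i b) - (v i + fc i a), (v i + fc i c) - (v i + fc i b)⟫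
          rw [add_sub_add_left_eq_sub, add_sub_add_left_eq_sub]
          exact h
        · exact hsymm _ _ (hcross j i hij t s)

end node

lemma all_good (g : DTBC) : ∀ (u : Pt) (η ρ : ℝ), 0 < η → 0 < ρ → 4 * η ≤ ‖u‖ →
    ∃ f, GoodDr g u η ρ f := by
  induction g with
  | leaf =>
    intro u η ρ hη hρ _
    have hs : ∀ a b : DTBC.leaf.Vert, a = b := fun a b => Subsingleton.elim (α := PUnit) a b
    refine ⟨fun _ => 0, ⟨rfl, fun a b _ => hs a b, fun _ => by simpa using hρ,
      fun _ => CK_zero _ _, trivial, fun t => ?_, fun s t => ?_⟩⟩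
    · obtain rfl := hs t DTBC.leaf.root
      exact ⟨SimpleGraph.Walk.nil, by simp⟩
    · obtain rfl := hs s t
      exact ⟨SimpleGraph.Walk.nil, by simp, by simp⟩
  | node k hk ch ih =>
    intro u η ρ hη hρ h4
    exact node_good u η ρ hη hρ h4 ih

/-- Every downward-triangulated binary cactus admits an increasing-chord drawing
in which every downward edge direction forms an angle at most `ε/2` with the
upward vertical direction. -/
theorem stmt4 (k : ℕ) (hk : 1 ≤ k) (ch : Fin k → DTBC) (ε : ℝ)
    (hε0 : 0 < ε) (hε : ε < π / 2) :
    ∃ f : (DTBC.node k hk ch).Vert → Pt,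
      IsIncreasingChordDrawing (DTBC.node k hk ch).graph f ∧
      (DTBC.node k hk ch).AngleOK (ε / 2) f := by
  obtain ⟨η, hη, h4, hang⟩ := CK_angle (half_pos hε0)
  obtain ⟨f, hf⟩ := all_good (DTBC.node k hk ch) e2 η 1 hη one_pos h4
  refine ⟨f, ⟨hf.inj, fun s t _ => ?_⟩, EdgeOK_angle (fun x hx => hang x hx.1 hx.2) _ _ hf.edges⟩
  obtain ⟨w, h1, h2⟩ := hf.pair s t
  exact ⟨w, h1, triple_IC h2⟩
end
end

section
/- There exist a constant c > 0 and, for every natural number N, a finite connected simple graph G with n ≥ N vertices such that every edge of G lies on at most one cycle (G is a cactus), every vertex of G has degree at most 4, and every strongly monotone straight-line drawing of G has resolution at least c · 2^{n/44}. -/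
open Real EuclideanGeometry
open scoped RealInnerProductSpace

noncomputable section

/-- A strongly monotone straight-line drawing: an injective map of the vertices
into the plane such that for every ordered pair of distinct vertices `s, t`
there is a path from `s` to `t` along which every edge has positive inner
product with `f t - f s`. -/
def IsStronglyMonotoneDrawing {V : Type*} (G : SimpleGraph V) (f : V → Pt) : Prop :=
  Function.Injective f ∧ ∀ s t : V, s ≠ t →
    ∃ w : G.Walk s t, w.IsPath ∧ ∀ i : ℕ, i + 1 < w.support.length →
      0 < ⟪(w.support.map f).getD (i + 1) 0 - (w.support.map f).getD i 0, f t - f s⟫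

/-- The resolution of a drawing: the ratio of the largest to the smallest
distance between images of distinct vertices. -/
def resolution {V : Type*} [Fintype V] (f : V → Pt) : ℝ :=
  (⨆ p : {p : V × V // p.1 ≠ p.2}, dist (f p.1.1) (f p.1.2)) /
  (⨅ p : {p : V × V // p.1 ≠ p.2}, dist (f p.1.1) (f p.1.2))

/-- A cactus: a connected graph in which every edge lies on at most one cycle,
i.e. any two cycles sharing an edge have the same edge set. -/
def IsCactus {V : Type*} (G : SimpleGraph V) : Prop :=
  G.Connected ∧ ∀ (u v : V) (c₁ : G.Walk u u) (c₂ : G.Walk v v),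
    c₁.IsCycle → c₂.IsCycle → ∀ e, e ∈ c₁.edges → e ∈ c₂.edges →
      ∀ e', e' ∈ c₁.edges ↔ e' ∈ c₂.edges


namespace CactusRes

/-- Strongly monotone drawings separate along cuts consisting of one edge. -/
lemma mono_cut {V : Type*} {G : SimpleGraph V} {f : V → Pt}
    (hf : IsStronglyMonotoneDrawing G f) (S : Set V) (u v : V)
    (hS : ∀ x y, x ∉ S → y ∈ S → G.Adj x y → x = u ∧ y = v)
    (s t : V) (hs : s ∉ S) (ht : t ∈ S) : 0 < ⟪f v - f u, f t - f s⟫ := by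
  obtain ⟨w, -, hw⟩ := hf.2 s t (by rintro rfl; exact hs ht)
  have hex : ∃ n, w.getVert n ∈ S := ⟨w.length, by simpa using ht⟩
  classical
  obtain ⟨m, hm⟩ : ∃ m, Nat.find hex = m + 1 := by
    apply Nat.exists_eq_succ_of_ne_zero
    intro h0
    have := Nat.find_spec hex
    rw [h0] at this
    exact hs (by simpa using this)
  have h1 : w.getVert (m + 1) ∈ S := hm ▸ Nat.find_spec hex
  have h2 : w.getVert m ∉ S := Nat.find_min hex (by omega)
  have hlt : m < w.length := by
    by_contra hc
    have e1 : w.getVert m = t := w.getVert_of_length_le (by omega)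
    exact h2 (by rw [e1]; exact ht)
  obtain ⟨e1, e2⟩ := hS _ _ h2 h1 (w.adj_getVert_succ hlt)
  have hl := w.length_support
  have key := hw m (by omega)
  have g : ∀ n, n ≤ w.length → (w.support.map f).getD n 0 = f (w.getVert n) := by
    intro n hn
    rw [List.getD_eq_getElem _ _ (by simp; omega)]
    simp [SimpleGraph.Walk.support_getElem_eq_getVert]
  rw [g _ (by omega), g _ (by omega), e1, e2] at key
  exact key

/-- Elementary estimate: a vector in a narrow cone. -/
lemma cone_aux {p q X Y : ℝ} (h : |p| ≤ q / 4) (hp : 0 < p * X + q * Y) : -(|X| / 4) < Y := by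
  have hq : 0 ≤ q := by have := abs_nonneg p; linarith
  have h1 : p * X ≤ q / 4 * |X| := by
    calc p * X ≤ |p * X| := le_abs_self _
      _ = |p| * |X| := abs_mul _ _
      _ ≤ _ := by gcongr
  by_contra hc
  push Not at hc
  nlinarith

/-- The shrinking step. -/
lemma shrink {ax ay wx wy bx b' : ℝ} (ha : |ax| ≤ ay / 4) (hw : |wx| ≤ wy / 4)
    (hb : |bx| ≤ b' / 4)
    (h1 : 0 < ax * (ax - wx) + ay * (ay - wy))
    (h2 : 0 < wx * (wx - ax) + wy * (wy - ay))
    (h3 : 0 < bx * (bx + wx - ax) + b' * (b' + wy - ay))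
    (h4 : 0 < ax * (ax - wx - bx) + ay * (ay - wy - b')) : b' ≤ ay / 2 := by
  have k1 := cone_aux ha h1
  have k2 := cone_aux hw h2
  have k3 := cone_aux hb h3
  have k4 := cone_aux ha h4
  rw [abs_sub_comm wx ax] at k2
  have e : |bx + wx - ax| = |ax - wx - bx| := by rw [← abs_neg]; congr 1; ring
  rw [e] at k3
  have t1 : |ax - wx| ≤ |ax| + |wx| := abs_sub _ _
  have t2 : |ax - wx - bx| ≤ |ax - wx| + |bx| := abs_sub _ _
  linarith

/-- All vectors of a star-shaped cone avoiding 16 directions lie in a narrow cone. -/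
lemma sector (D : ℝ → ℝ → Prop) (s0 s1 : ℝ)
    (hs : D s0 s1)
    (hcomb : ∀ r0 r1 α β, D r0 r1 → 0 ≤ α → 0 ≤ β → 0 < α + β →
      D (α * r0 + β * s0) (α * r1 + β * s1))
    (hscale : ∀ r0 r1 c, D (c * r0) (c * r1) → 0 < c → D r0 r1)
    (hz : ¬ D 0 0)
    (hav : ∀ a b : ℝ, (a, b) ∈ ({(1,0),(0,1),(1,1),(1,-1),(2,1),(2,-1),(1,2),(1,-2)} : Set (ℝ × ℝ)) →
      ¬ D a b ∧ ¬ D (-a) (-b)) :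
    ∃ u0 u1 : ℝ, 0 < u0 ^ 2 + u1 ^ 2 ∧ ∀ r0 r1, D r0 r1 →
      |u0 * r1 - u1 * r0| ≤ (u0 * r0 + u1 * r1) / 4 := by
  have line : ∀ a b : ℝ, (a, b) ∈ ({(1,0),(0,1),(1,1),(1,-1),(2,1),(2,-1),(1,2),(1,-2)} : Set (ℝ × ℝ)) →
      ∀ r0 r1, D r0 r1 → a * r1 - b * r0 ≠ 0 := by
    intro a b hab r0 r1 hr h0
    obtain ⟨hp, hn⟩ := hav a b hab
    have hab0 : 0 < a * a + b * b := by
      simp only [Set.mem_insert_iff, Set.mem_singleton_iff, Prod.mk.injEq] at hab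
      rcases hab with ⟨rfl, rfl⟩ | ⟨rfl, rfl⟩ | ⟨rfl, rfl⟩ | ⟨rfl, rfl⟩ | ⟨rfl, rfl⟩ | ⟨rfl, rfl⟩ |
        ⟨rfl, rfl⟩ | ⟨rfl, rfl⟩ <;> norm_num
    set c := (a * r0 + b * r1) / (a * a + b * b) with hc
    have e0 : r0 = c * a := by
      rw [hc, div_mul_eq_mul_div, eq_div_iff hab0.ne']; linear_combination (-b) * h0
    have e1 : r1 = c * b := by
      rw [hc, div_mul_eq_mul_div, eq_div_iff hab0.ne']; linear_combination a * h0
    rcases lt_trichotomy c 0 with h | h | h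
    · apply hn
      apply hscale _ _ (-c) _ (by linarith)
      convert hr using 1
      · rw [e0]; ring
      · rw [e1]; ring
    · apply hz
      rw [e0, e1, h] at hr
      simpa using hr
    · apply hp
      apply hscale _ _ c _ h
      rw [← e0, ← e1]; exact hr
  have sign : ∀ a b : ℝ, (a, b) ∈ ({(1,0),(0,1),(1,1),(1,-1),(2,1),(2,-1),(1,2),(1,-2)} : Set (ℝ × ℝ)) →
      ∀ r0 r1, D r0 r1 → 0 < (a * r1 - b * r0) * (a * s1 - b * s0) := by
    intro a b hab r0 r1 hr
    have n1 := line a b hab r0 r1 hr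
    have n2 := line a b hab s0 s1 hs
    by_contra hc
    push Not at hc
    have := line a b hab _ _ (hcomb r0 r1 |a * s1 - b * s0| |a * r1 - b * r0| hr
      (abs_nonneg _) (abs_nonneg _) (add_pos (abs_pos.2 n2) (abs_pos.2 n1)))
    apply this
    rcases lt_or_gt_of_ne n1 with h1 | h1 <;> rcases lt_or_gt_of_ne n2 with h2 | h2
    · nlinarith
    · rw [abs_of_neg h1, abs_of_pos h2]; ring
    · rw [abs_of_pos h1, abs_of_neg h2]; ring
    · nlinarith
  have pos : ∀ a b : ℝ, (a, b) ∈ ({(1,0),(0,1),(1,1),(1,-1),(2,1),(2,-1),(1,2),(1,-2)} : Set (ℝ × ℝ)) →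
      (∀ r0 r1, D r0 r1 → 0 < a * r1 - b * r0) ∨ (∀ r0 r1, D r0 r1 → a * r1 - b * r0 < 0) := by
    intro a b hab
    rcases lt_or_gt_of_ne (line a b hab s0 s1 hs) with h | h
    · right; intro r0 r1 hr
      have := sign a b hab r0 r1 hr
      by_contra hc; push Not at hc; nlinarith
    · left; intro r0 r1 hr
      have := sign a b hab r0 r1 hr
      by_contra hc; push Not at hc; nlinarith
  have fin : ∀ u0 u1 : ℝ, 0 < u0 ^ 2 + u1 ^ 2 → (∀ r0 r1, D r0 r1 →
      u0 * r1 - u1 * r0 ≤ (u0 * r0 + u1 * r1) / 4 ∧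
      -((u0 * r0 + u1 * r1) / 4) ≤ u0 * r1 - u1 * r0) →
      ∃ u0 u1 : ℝ, 0 < u0 ^ 2 + u1 ^ 2 ∧ ∀ r0 r1, D r0 r1 →
      |u0 * r1 - u1 * r0| ≤ (u0 * r0 + u1 * r1) / 4 := by
    intro u0 u1 hu h
    exact ⟨u0, u1, hu, fun r0 r1 hr => abs_le.2 ⟨(h r0 r1 hr).2, (h r0 r1 hr).1⟩⟩
  have L1 := pos 1 0 (by simp)
  have L2 := pos 0 1 (by simp)
  have L3 := pos 1 1 (by simp)
  have L4 := pos 1 (-1) (by simp)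
  have L5 := pos 2 1 (by simp)
  have L6 := pos 2 (-1) (by simp)
  have L7 := pos 1 2 (by simp)
  have L8 := pos 1 (-2) (by simp)
  clear pos sign line hav hscale hcomb hz
  rcases L1 with L1 | L1 <;> rcases L2 with L2 | L2 <;>
  rcases L3 with L3 | L3 <;> rcases L4 with L4 | L4 <;>
  have l1 := L1 s0 s1 hs <;> have l2 := L2 s0 s1 hs <;>
  have l3 := L3 s0 s1 hs <;> have l4 := L4 s0 s1 hs <;>
  first
  | (exfalso; linarith)
  | (rcases L5 with L5 | L5 <;> rcases L6 with L6 | L6 <;>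
     rcases L7 with L7 | L7 <;> rcases L8 with L8 | L8 <;>
     have l5 := L5 s0 s1 hs <;> have l6 := L6 s0 s1 hs <;>
     have l7 := L7 s0 s1 hs <;> have l8 := L8 s0 s1 hs <;>
     first
     | (exfalso; linarith)
     | (first
        | refine fin 4 1 (by norm_num) (fun r0 r1 hr => ?_); have m1 := L1 r0 r1 hr; have m2 := L2 r0 r1 hr; have m3 := L3 r0 r1 hr; have m4 := L4 r0 r1 hr; have m5 := L5 r0 r1 hr; have m6 := L6 r0 r1 hr; have m7 := L7 r0 r1 hr; have m8 := L8 r0 r1 hr; constructor <;> linarith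
        | refine fin (4) (-1) (by norm_num) (fun r0 r1 hr => ?_); have m1 := L1 r0 r1 hr; have m2 := L2 r0 r1 hr; have m3 := L3 r0 r1 hr; have m4 := L4 r0 r1 hr; have m5 := L5 r0 r1 hr; have m6 := L6 r0 r1 hr; have m7 := L7 r0 r1 hr; have m8 := L8 r0 r1 hr; constructor <;> linarith
        | refine fin (-4) (1) (by norm_num) (fun r0 r1 hr => ?_); have m1 := L1 r0 r1 hr; have m2 := L2 r0 r1 hr; have m3 := L3 r0 r1 hr; have m4 := L4 r0 r1 hr; have m5 := L5 r0 r1 hr; have m6 := L6 r0 r1 hr; have m7 := L7 r0 r1 hr; have m8 := L8 r0 r1 hr; constructor <;> linarith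
        | refine fin (-4) (-1) (by norm_num) (fun r0 r1 hr => ?_); have m1 := L1 r0 r1 hr; have m2 := L2 r0 r1 hr; have m3 := L3 r0 r1 hr; have m4 := L4 r0 r1 hr; have m5 := L5 r0 r1 hr; have m6 := L6 r0 r1 hr; have m7 := L7 r0 r1 hr; have m8 := L8 r0 r1 hr; constructor <;> linarith
        | refine fin (3) (2) (by norm_num) (fun r0 r1 hr => ?_); have m1 := L1 r0 r1 hr; have m2 := L2 r0 r1 hr; have m3 := L3 r0 r1 hr; have m4 := L4 r0 r1 hr; have m5 := L5 r0 r1 hr; have m6 := L6 r0 r1 hr; have m7 := L7 r0 r1 hr; have m8 := L8 r0 r1 hr; constructor <;> linarith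
        | refine fin (3) (-2) (by norm_num) (fun r0 r1 hr => ?_); have m1 := L1 r0 r1 hr; have m2 := L2 r0 r1 hr; have m3 := L3 r0 r1 hr; have m4 := L4 r0 r1 hr; have m5 := L5 r0 r1 hr; have m6 := L6 r0 r1 hr; have m7 := L7 r0 r1 hr; have m8 := L8 r0 r1 hr; constructor <;> linarith
        | refine fin (-3) (2) (by norm_num) (fun r0 r1 hr => ?_); have m1 := L1 r0 r1 hr; have m2 := L2 r0 r1 hr; have m3 := L3 r0 r1 hr; have m4 := L4 r0 r1 hr; have m5 := L5 r0 r1 hr; have m6 := L6 r0 r1 hr; have m7 := L7 r0 r1 hr; have m8 := L8 r0 r1 hr; constructor <;> linarith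
        | refine fin (-3) (-2) (by norm_num) (fun r0 r1 hr => ?_); have m1 := L1 r0 r1 hr; have m2 := L2 r0 r1 hr; have m3 := L3 r0 r1 hr; have m4 := L4 r0 r1 hr; have m5 := L5 r0 r1 hr; have m6 := L6 r0 r1 hr; have m7 := L7 r0 r1 hr; have m8 := L8 r0 r1 hr; constructor <;> linarith
        | refine fin (2) (3) (by norm_num) (fun r0 r1 hr => ?_); have m1 := L1 r0 r1 hr; have m2 := L2 r0 r1 hr; have m3 := L3 r0 r1 hr; have m4 := L4 r0 r1 hr; have m5 := L5 r0 r1 hr; have m6 := L6 r0 r1 hr; have m7 := L7 r0 r1 hr; have m8 := L8 r0 r1 hr; constructor <;> linarith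
        | refine fin (2) (-3) (by norm_num) (fun r0 r1 hr => ?_); have m1 := L1 r0 r1 hr; have m2 := L2 r0 r1 hr; have m3 := L3 r0 r1 hr; have m4 := L4 r0 r1 hr; have m5 := L5 r0 r1 hr; have m6 := L6 r0 r1 hr; have m7 := L7 r0 r1 hr; have m8 := L8 r0 r1 hr; constructor <;> linarith
        | refine fin (-2) (3) (by norm_num) (fun r0 r1 hr => ?_); have m1 := L1 r0 r1 hr; have m2 := L2 r0 r1 hr; have m3 := L3 r0 r1 hr; have m4 := L4 r0 r1 hr; have m5 := L5 r0 r1 hr; have m6 := L6 r0 r1 hr; have m7 := L7 r0 r1 hr; have m8 := L8 r0 r1 hr; constructor <;> linarith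
        | refine fin (-2) (-3) (by norm_num) (fun r0 r1 hr => ?_); have m1 := L1 r0 r1 hr; have m2 := L2 r0 r1 hr; have m3 := L3 r0 r1 hr; have m4 := L4 r0 r1 hr; have m5 := L5 r0 r1 hr; have m6 := L6 r0 r1 hr; have m7 := L7 r0 r1 hr; have m8 := L8 r0 r1 hr; constructor <;> linarith
        | refine fin (1) (4) (by norm_num) (fun r0 r1 hr => ?_); have m1 := L1 r0 r1 hr; have m2 := L2 r0 r1 hr; have m3 := L3 r0 r1 hr; have m4 := L4 r0 r1 hr; have m5 := L5 r0 r1 hr; have m6 := L6 r0 r1 hr; have m7 := L7 r0 r1 hr; have m8 := L8 r0 r1 hr; constructor <;> linarith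
        | refine fin (1) (-4) (by norm_num) (fun r0 r1 hr => ?_); have m1 := L1 r0 r1 hr; have m2 := L2 r0 r1 hr; have m3 := L3 r0 r1 hr; have m4 := L4 r0 r1 hr; have m5 := L5 r0 r1 hr; have m6 := L6 r0 r1 hr; have m7 := L7 r0 r1 hr; have m8 := L8 r0 r1 hr; constructor <;> linarith
        | refine fin (-1) (4) (by norm_num) (fun r0 r1 hr => ?_); have m1 := L1 r0 r1 hr; have m2 := L2 r0 r1 hr; have m3 := L3 r0 r1 hr; have m4 := L4 r0 r1 hr; have m5 := L5 r0 r1 hr; have m6 := L6 r0 r1 hr; have m7 := L7 r0 r1 hr; have m8 := L8 r0 r1 hr; constructor <;> linarith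
        | refine fin (-1) (-4) (by norm_num) (fun r0 r1 hr => ?_); have m1 := L1 r0 r1 hr; have m2 := L2 r0 r1 hr; have m3 := L3 r0 r1 hr; have m4 := L4 r0 r1 hr; have m5 := L5 r0 r1 hr; have m6 := L6 r0 r1 hr; have m7 := L7 r0 r1 hr; have m8 := L8 r0 r1 hr; constructor <;> linarith))

/-- The spine and leaf tree. -/
abbrev Vx (k : ℕ) : Type := Fin 17 × Fin (k + 1) × Bool

/-- Directed edges, parent to child. -/
def E {k : ℕ} (x y : Vx k) : Prop :=
  x.2.2 = false ∧
  ((y.2.2 = true ∧ y.1.val = x.1.val ∧ y.2.1.val = x.2.1.val) ∨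
   (y.2.2 = false ∧ y.1.val = x.1.val ∧ y.2.1.val = x.2.1.val + 1) ∨
   (y.2.2 = false ∧ y.1.val = x.1.val + 1 ∧ x.2.1.val = 0 ∧ y.2.1.val = 0))

/-- The graph. -/
def T (k : ℕ) : SimpleGraph (Vx k) where
  Adj x y := E x y ∨ E y x
  symm := ⟨fun _ _ h => h.symm⟩
  loopless := ⟨fun x h => by unfold E at h; rcases h with h | h <;> (rcases h with ⟨h1, h | h | h⟩ <;> simp_all)⟩

/-- Descendants of a vertex. -/
def Desc {k : ℕ} (v : Vx k) : Set (Vx k) := {x |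
  (v.2.2 = true ∧ x = v) ∨
  (v.2.2 = false ∧ 0 < v.2.1.val ∧ x.1.val = v.1.val ∧ v.2.1.val ≤ x.2.1.val) ∨
  (v.2.2 = false ∧ v.2.1.val = 0 ∧ v.1.val ≤ x.1.val)}

lemma vext {k : ℕ} {x y : Vx k} (h1 : x.1.val = y.1.val) (h2 : x.2.1.val = y.2.1.val)
    (h3 : x.2.2 = y.2.2) : x = y := by
  obtain ⟨x1, x2, x3⟩ := x
  obtain ⟨y1, y2, y3⟩ := y
  simp only [Prod.mk.injEq]
  exact ⟨Fin.ext h1, Fin.ext h2, h3⟩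

lemma cut {k : ℕ} (u v : Vx k) (h : E u v) : ∀ x y, x ∉ Desc v → y ∈ Desc v →
    (T k).Adj x y → x = u ∧ y = v := by
  rintro ⟨⟨x1, _⟩, ⟨x2, _⟩, x3⟩ ⟨⟨y1, _⟩, ⟨y2, _⟩, y3⟩ hx hy hxy
  obtain ⟨⟨u1, _⟩, ⟨u2, _⟩, u3⟩ := u
  obtain ⟨⟨v1, _⟩, ⟨v2, _⟩, v3⟩ := v
  simp only [Desc, T, E, Set.mem_ofPred_eq, Prod.mk.injEq, Fin.ext_iff] at *
  cases x3 <;> cases y3 <;> cases u3 <;> cases v3 <;> simp at * <;> omega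

lemma not_mem_desc {k : ℕ} (u v : Vx k) (h : E u v) : u ∉ Desc v := by
  obtain ⟨⟨u1, _⟩, ⟨u2, _⟩, u3⟩ := u
  obtain ⟨⟨v1, _⟩, ⟨v2, _⟩, v3⟩ := v
  simp only [Desc, E, Set.mem_ofPred_eq, Prod.mk.injEq, Fin.ext_iff] at *
  cases u3 <;> cases v3 <;> simp at * <;> omega

lemma self_mem_desc {k : ℕ} (v : Vx k) : v ∈ Desc v := by
  obtain ⟨⟨v1, _⟩, ⟨v2, _⟩, v3⟩ := v
  simp only [Desc, Set.mem_ofPred_eq]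
  cases v3 <;> simp
  omega

lemma bridge {k : ℕ} (u v : Vx k) (h : E u v) : (T k).IsBridge s(u, v) := by
  rw [SimpleGraph.isBridge_iff]
  rintro ⟨w⟩
  obtain ⟨d, hd, h1, h2⟩ := w.exists_boundary_dart (Desc v)ᶜ (not_mem_desc u v h)
    (by simpa using self_mem_desc v)
  have ha := d.adj
  rw [SimpleGraph.deleteEdges_adj] at ha
  simp only [Set.mem_compl_iff, not_not] at h1 h2
  obtain ⟨e1, e2⟩ := cut u v h _ _ h1 h2 ha.1
  apply ha.2
  rw [e1, e2]; simp

lemma acyclic (k : ℕ) : (T k).IsAcyclic := by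
  rw [SimpleGraph.isAcyclic_iff_forall_adj_isBridge]
  intro u v h
  rcases h with h | h
  · exact bridge u v h
  · rw [Sym2.eq_swap]; exact bridge v u h

lemma connected (k : ℕ) : (T k).Connected := by
  have h0 : ∀ i (hi : i < 17), (T k).Reachable (0, 0, false) (⟨i, hi⟩, 0, false) := by
    intro i
    induction i with
    | zero => intro _; exact SimpleGraph.Reachable.refl _
    | succ i ih =>
      intro hi
      refine (ih (by omega)).trans (SimpleGraph.Adj.reachable ?_)
      left; simp [E]
  have h1 : ∀ (i : Fin 17) j (hj : j < k + 1), (T k).Reachable (0, 0, false) (i, ⟨j, hj⟩, false) := by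
    intro i j
    induction j with
    | zero => intro _; exact h0 i.1 i.2
    | succ j ih =>
      intro hj
      refine (ih (by omega)).trans (SimpleGraph.Adj.reachable ?_)
      left; simp [E]
  have h2 : ∀ x : Vx k, (T k).Reachable (0, 0, false) x := by
    rintro ⟨i, j, b⟩
    cases b
    · exact h1 i j.1 j.2
    · refine (h1 i j.1 j.2).trans (SimpleGraph.Adj.reachable ?_)
      left; simp [E]
  have : Nonempty (Vx k) := ⟨(0, 0, false)⟩
  exact ⟨fun x y => (h2 x).symm.trans (h2 y)⟩

lemma cactus (k : ℕ) : IsCactus (T k) :=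
  ⟨connected k, fun u _ c₁ _ h1 => absurd h1 (acyclic k c₁)⟩

lemma degree_le (k : ℕ) (v : Vx k) : ((T k).neighborSet v).ncard ≤ 4 := by
  let g : Vx k → ℕ × ℕ × Bool := fun y => (y.1.val, y.2.1.val, y.2.2)
  have hg : Function.Injective g := by
    intro x y h
    simp only [g, Prod.mk.injEq] at h
    exact vext h.1 h.2.1 h.2.2
  rw [← Set.ncard_image_of_injective _ hg]
  have key : ∃ a b c d : ℕ × ℕ × Bool,
      g '' (T k).neighborSet v ⊆ (({a, b, c, d} : Finset (ℕ × ℕ × Bool)) : Set (ℕ × ℕ × Bool)) := by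
    obtain ⟨⟨i, _⟩, ⟨j, _⟩, b⟩ := v
    cases b
    · by_cases hj : j = 0
      · refine ⟨(i + 1, 0, false), (i - 1, 0, false), (i, 1, false),
          (i, 0, true), ?_⟩
        rintro _ ⟨⟨⟨y1, _⟩, ⟨y2, _⟩, y3⟩, hy, rfl⟩
        simp only [SimpleGraph.mem_neighborSet, T, E] at hy
        cases y3 <;> simp [g] at * <;> omega
      · refine ⟨(i, j + 1, false), (i, j - 1, false), (i, j, true),
          (i, j, true), ?_⟩
        rintro _ ⟨⟨⟨y1, _⟩, ⟨y2, _⟩, y3⟩, hy, rfl⟩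
        simp only [SimpleGraph.mem_neighborSet, T, E] at hy
        cases y3 <;> simp [g] at * <;> omega
    · refine ⟨(i, j, false), (i, j, false), (i, j, false),
          (i, j, false), ?_⟩
      rintro _ ⟨⟨⟨y1, _⟩, ⟨y2, _⟩, y3⟩, hy, rfl⟩
      simp only [SimpleGraph.mem_neighborSet, T, E] at hy
      cases y3 <;> simp [g] at * <;> omega
  obtain ⟨a, b, c, d, h⟩ := key
  refine (Set.ncard_le_ncard h (Finset.finite_toSet _)).trans ?_
  rw [Set.ncard_coe_finset]
  exact Finset.card_le_four

/-- The `i`-th branch. -/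
def Br {k : ℕ} (i : Fin 17) : Set (Vx k) := {x | x.1 = i ∧ 0 < x.2.1.val}

/-- Directions in which the `i`-th branch is extreme. -/
def Dir {k : ℕ} (f : Vx k → Pt) (i : Fin 17) (r0 r1 : ℝ) : Prop :=
  ∃ a ∈ Br i, ∀ b, b ∉ Br i → 0 < r0 * (f a 0 - f b 0) + r1 * (f a 1 - f b 1)

lemma inner_eq (a b c d : Pt) : ⟪a - b, c - d⟫ =
    (a 0 - b 0) * (c 0 - d 0) + (a 1 - b 1) * (c 1 - d 1) := by
  simp [PiLp.inner_apply, Fin.sum_univ_two]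
  ring

lemma dist_eq' (a b : Pt) : dist a b ^ 2 = (a 0 - b 0) ^ 2 + (a 1 - b 1) ^ 2 := by
  rw [EuclideanSpace.dist_eq, Real.sq_sqrt (by positivity)]
  simp [Fin.sum_univ_two, Real.dist_eq, sq_abs]

lemma mono {k : ℕ} {f : Vx k → Pt} (hf : IsStronglyMonotoneDrawing (T k) f) {u v : Vx k}
    (h : E u v) (s t : Vx k) (hs : s ∉ Desc v) (ht : t ∈ Desc v) :
    0 < (f v 0 - f u 0) * (f t 0 - f s 0) + (f v 1 - f u 1) * (f t 1 - f s 1) := by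
  rw [← inner_eq]
  exact mono_cut hf (Desc v) u v (cut u v h) s t hs ht

lemma desc_sub {k : ℕ} {v : Vx k} (h : 0 < v.2.1.val) : Desc v ⊆ Br v.1 := by
  rintro ⟨⟨x1, _⟩, ⟨x2, _⟩, x3⟩ hx
  obtain ⟨⟨v1, _⟩, ⟨v2, _⟩, v3⟩ := v
  simp only [Desc, Br, Set.mem_ofPred_eq, Prod.mk.injEq, Fin.ext_iff] at *
  omega

lemma dir_edge {k : ℕ} {f : Vx k → Pt} (hf : IsStronglyMonotoneDrawing (T k) f) {u v : Vx k}
    (h : E u v) (hv : 0 < v.2.1.val) : Dir f v.1 (f v 0 - f u 0) (f v 1 - f u 1) :=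
  ⟨v, desc_sub hv (self_mem_desc v), fun b hb =>
    mono hf h b v (fun hb' => hb (desc_sub hv hb')) (self_mem_desc v)⟩

/-- The sixteen directions. -/
def dirs : Finset (ℝ × ℝ) :=
  {(1,0),(0,1),(1,1),(1,-1),(2,1),(2,-1),(1,2),(1,-2),
   (-1,-0),(-0,-1),(-1,-1),(-1,- -1),(-2,-1),(-2,- -1),(-1,-2),(-1,- -2)}

lemma dirs_card : dirs.card ≤ 16 := by
  unfold dirs
  iterate 15 refine (Finset.card_insert_le _ _).trans (Nat.succ_le_succ ?_)
  simp

lemma dir_unique {k : ℕ} {f : Vx k → Pt} {i j : Fin 17} {r0 r1 : ℝ}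
    (hi : Dir f i r0 r1) (hj : Dir f j r0 r1) : i = j := by
  by_contra hne
  obtain ⟨a, ha, ha'⟩ := hi
  obtain ⟨b, hb, hb'⟩ := hj
  have h1 := ha' b (fun h => hne (h.1.symm.trans hb.1))
  have h2 := hb' a (fun h => hne (ha.1.symm.trans h.1))
  linarith

lemma exists_branch {k : ℕ} (f : Vx k → Pt) :
    ∃ i : Fin 17, ∀ r ∈ dirs, ¬ Dir f i r.1 r.2 := by
  by_contra hc
  push Not at hc
  choose g hg hg' using hc
  have hinj : Function.Injective g := by
    intro i j hij
    apply dir_unique (hg' i)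
    rw [hij]; exact hg' j
  have := Finset.card_le_card_of_injOn (s := Finset.univ) (t := dirs) g (fun i _ => hg i)
    hinj.injOn
  have h16 := dirs_card
  simp at this
  omega

lemma narrow {k : ℕ} (hk : 0 < k) {f : Vx k → Pt} (hf : IsStronglyMonotoneDrawing (T k) f) :
    ∃ (i : Fin 17) (u0 u1 : ℝ), 0 < u0 ^ 2 + u1 ^ 2 ∧ ∀ r0 r1, Dir f i r0 r1 →
      |u0 * r1 - u1 * r0| ≤ (u0 * r0 + u1 * r1) / 4 := by
  obtain ⟨i, hi⟩ := exists_branch f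
  refine ⟨i, ?_⟩
  let p : Vx k := (i, ⟨0, by omega⟩, false)
  let q : Vx k := (i, ⟨1, by omega⟩, false)
  have hpq : E p q := by simp [E, p, q]
  have hq : Desc q = Br i := by
    ext ⟨⟨x1, _⟩, ⟨x2, _⟩, x3⟩
    simp only [Desc, Br, q, Set.mem_ofPred_eq, Fin.ext_iff]
    simp
    omega
  have hout : p ∉ Br i := by simp [Br, p]
  have hs := fun a (ha : a ∈ Br i) b (hb : b ∉ Br i) => mono hf hpq b a (hq ▸ hb) (hq ▸ ha)
  refine sector (Dir f i) (f q 0 - f p 0) (f q 1 - f p 1) (dir_edge hf hpq (by simp [q]))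
    ?_ ?_ ?_ ?_
  · rintro r0 r1 α β ⟨a, ha, h⟩ hα hβ hαβ
    refine ⟨a, ha, fun b hb => ?_⟩
    have h1 := h b hb
    have h2 := hs a ha b hb
    rcases hα.eq_or_lt with h0 | h0
    · have : 0 < β := by linarith
      have := mul_pos this h2
      rw [← h0]; linarith
    · have := mul_pos h0 h1
      have := mul_nonneg hβ h2.le
      linarith
  · rintro r0 r1 c ⟨a, ha, h⟩ hc
    refine ⟨a, ha, fun b hb => ?_⟩
    have := h b hb
    have e : c * r0 * (f a 0 - f b 0) + c * r1 * (f a 1 - f b 1) =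
      c * (r0 * (f a 0 - f b 0) + r1 * (f a 1 - f b 1)) := by ring
    rw [e] at this
    exact pos_of_mul_pos_right this hc.le
  · rintro ⟨a, ha, h⟩
    have := h p hout
    simp at this
  · intro a b hab
    constructor
    · refine hi (a, b) ?_
      simp only [Set.mem_insert_iff, Set.mem_singleton_iff, Prod.mk.injEq] at hab
      rcases hab with ⟨rfl, rfl⟩ | ⟨rfl, rfl⟩ | ⟨rfl, rfl⟩ | ⟨rfl, rfl⟩ | ⟨rfl, rfl⟩ | ⟨rfl, rfl⟩ |
        ⟨rfl, rfl⟩ | ⟨rfl, rfl⟩ <;> simp [dirs]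
    · refine hi (-a, -b) ?_
      simp only [Set.mem_insert_iff, Set.mem_singleton_iff, Prod.mk.injEq] at hab
      rcases hab with ⟨rfl, rfl⟩ | ⟨rfl, rfl⟩ | ⟨rfl, rfl⟩ | ⟨rfl, rfl⟩ | ⟨rfl, rfl⟩ | ⟨rfl, rfl⟩ |
        ⟨rfl, rfl⟩ | ⟨rfl, rfl⟩ <;> simp [dirs]

lemma rot {u0 u1 p q r s : ℝ} (hu : 0 < u0 ^ 2 + u1 ^ 2) (h : 0 < p * r + q * s) :
    0 < (u0 * q - u1 * p) * (u0 * s - u1 * r) + (u0 * p + u1 * q) * (u0 * r + u1 * s) := by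
  have := mul_pos hu h
  linarith

lemma step {k : ℕ} {f : Vx k → Pt} (hf : IsStronglyMonotoneDrawing (T k) f)
    (i : Fin 17) (u0 u1 : ℝ) (hu : 0 < u0 ^ 2 + u1 ^ 2)
    (hD : ∀ r0 r1, Dir f i r0 r1 → |u0 * r1 - u1 * r0| ≤ (u0 * r0 + u1 * r1) / 4)
    (j : ℕ) (hj : 0 < j) (hjk : j + 1 < k + 1) (v a w b : Vx k)
    (hv : v = (i, ⟨j, by omega⟩, false)) (ha : a = (i, ⟨j, by omega⟩, true))
    (hw : w = (i, ⟨j + 1, by omega⟩, false)) (hb : b = (i, ⟨j + 1, by omega⟩, true)) :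
    u0 * (f b 0 - f w 0) + u1 * (f b 1 - f w 1) ≤
      (u0 * (f a 0 - f v 0) + u1 * (f a 1 - f v 1)) / 2 := by
  have e1 : E v a := by subst hv ha; simp [E]
  have e2 : E v w := by subst hv hw; simp [E]
  have e3 : E w b := by subst hw hb; simp [E]
  have a1 : a.1 = i := by rw [ha]
  have w1 : w.1 = i := by rw [hw]
  have b1 : b.1 = i := by rw [hb]
  have d1 := hD _ _ (a1 ▸ dir_edge hf e1 (by rw [ha]; exact hj))
  have d2 := hD _ _ (w1 ▸ dir_edge hf e2 (by rw [hw]; simp))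
  have d3 := hD _ _ (b1 ▸ dir_edge hf e3 (by rw [hb]; simp))
  have m1 := rot hu (mono hf e1 w a (by subst ha hw; simp [Desc]) (self_mem_desc a))
  have m2 := rot hu (mono hf e2 a w (by subst ha hw; simp [Desc]) (self_mem_desc w))
  have m3 := rot hu (mono hf e3 a b (by subst ha hb; simp [Desc]) (self_mem_desc b))
  have m4 := rot hu (mono hf e1 b a (by subst ha hb; simp [Desc]) (self_mem_desc a))
  refine shrink d1 d2 d3 ?_ ?_ ?_ ?_
  · convert m1 using 1; ring
  · convert m2 using 1; ring
  · convert m3 using 1; ring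
  · convert m4 using 1; ring

lemma main {k : ℕ} (hk : 0 < k) {f : Vx k → Pt} (hf : IsStronglyMonotoneDrawing (T k) f) :
    ∃ p q p' q' : Vx k, p ≠ q ∧ p' ≠ q' ∧ 2 ^ (k - 1) * dist (f p) (f q) ≤ 2 * dist (f p') (f q') := by
  obtain ⟨i, u0, u1, hu, hD⟩ := narrow hk hf
  have ind : ∀ j (hj : j + 1 < k + 1),
      2 ^ j * (u0 * (f (i, ⟨j + 1, hj⟩, true) 0 - f (i, ⟨j + 1, hj⟩, false) 0) +
        u1 * (f (i, ⟨j + 1, hj⟩, true) 1 - f (i, ⟨j + 1, hj⟩, false) 1)) ≤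
      (u0 * (f (i, ⟨1, by omega⟩, true) 0 - f (i, ⟨1, by omega⟩, false) 0) +
        u1 * (f (i, ⟨1, by omega⟩, true) 1 - f (i, ⟨1, by omega⟩, false) 1)) := by
    intro j
    induction j with
    | zero => intro hj; simp
    | succ j ih =>
      intro hj
      refine le_trans ?_ (ih (by omega))
      have := step hf i u0 u1 hu hD (j + 1) (by omega) hj _ _ _ _ rfl rfl rfl rfl
      rw [pow_succ, mul_assoc]
      gcongr
      linarith
  obtain ⟨m, rfl⟩ : ∃ m, k = m + 1 := ⟨k - 1, by omega⟩
  have h := ind m (by omega)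
  refine ⟨(i, ⟨m + 1, by omega⟩, true), (i, ⟨m + 1, by omega⟩, false),
    (i, ⟨1, by omega⟩, true), (i, ⟨1, by omega⟩, false), by simp, by simp, ?_⟩
  have hd := hD _ _ (dir_edge hf (u := (i, ⟨m + 1, by omega⟩, false))
    (v := (i, ⟨m + 1, by omega⟩, true)) (by simp [E]) (by simp))
  generalize f (i, ⟨m + 1, by omega⟩, true) = A at *
  generalize f (i, ⟨m + 1, by omega⟩, false) = B at *
  generalize f (i, ⟨1, by omega⟩, true) = C at *
  generalize f (i, ⟨1, by omega⟩, false) = F at *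
  have q1 := dist_eq' A B
  have q2 := dist_eq' C F
  have pw : (0:ℝ) < 2 ^ m := by positivity
  have hU : 0 < √(u0 ^ 2 + u1 ^ 2) := Real.sqrt_pos.2 hu
  have hU2 : √(u0 ^ 2 + u1 ^ 2) ^ 2 = u0 ^ 2 + u1 ^ 2 := Real.sq_sqrt hu.le
  set U := √(u0 ^ 2 + u1 ^ 2)
  set Y := u0 * (A 0 - B 0) + u1 * (A 1 - B 1) with hY
  set Z := u0 * (C 0 - F 0) + u1 * (C 1 - F 1) with hZ
  have hYn : 0 ≤ Y := by have := abs_nonneg (u0 * (A 1 - B 1) - u1 * (A 0 - B 0)); linarith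
  have s1 : U * dist A B ≤ 2 * Y := by
    apply le_of_sq_le_sq _ (by linarith)
    have hx : (u0 * (A 1 - B 1) - u1 * (A 0 - B 0)) ^ 2 ≤ (Y / 4) ^ 2 := sq_le_sq' (abs_le.1 hd).1 (abs_le.1 hd).2
    rw [mul_pow, hU2, q1]
    have : (u0 ^ 2 + u1 ^ 2) * ((A 0 - B 0) ^ 2 + (A 1 - B 1) ^ 2) =
      (u0 * (A 1 - B 1) - u1 * (A 0 - B 0)) ^ 2 + Y ^ 2 := by rw [hY]; ring
    rw [this]
    nlinarith [sq_nonneg Y]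
  have s2 : Z ≤ U * dist C F := by
    apply le_of_sq_le_sq _ (by positivity)
    rw [mul_pow, hU2, q2]
    have : (u0 ^ 2 + u1 ^ 2) * ((C 0 - F 0) ^ 2 + (C 1 - F 1) ^ 2) =
      (u0 * (C 1 - F 1) - u1 * (C 0 - F 0)) ^ 2 + Z ^ 2 := by rw [hZ]; ring
    rw [this]
    nlinarith [sq_nonneg (u0 * (C 1 - F 1) - u1 * (C 0 - F 0))]
  have s3 : U * (2 ^ m * dist A B) ≤ U * (2 * dist C F) := by
    calc U * (2 ^ m * dist A B) = 2 ^ m * (U * dist A B) := by ring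
      _ ≤ 2 ^ m * (2 * Y) := by gcongr
      _ = 2 * (2 ^ m * Y) := by ring
      _ ≤ 2 * Z := by gcongr
      _ ≤ 2 * (U * dist C F) := by gcongr
      _ = _ := by ring
  simpa using le_of_mul_le_mul_left s3 hU

lemma le_resolution {V : Type*} [Fintype V] {f : V → Pt} (hf : Function.Injective f)
    {p q p' q' : V} (h : p ≠ q) (h' : p' ≠ q') {x : ℝ} (hx : 0 ≤ x)
    (hd : x * dist (f p) (f q) ≤ dist (f p') (f q')) : x ≤ resolution f := by
  have : Nonempty {p : V × V // p.1 ≠ p.2} := ⟨⟨(p, q), h⟩⟩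
  have hfin : Finite {p : V × V // p.1 ≠ p.2} := inferInstance
  let g : {p : V × V // p.1 ≠ p.2} → ℝ := fun p => dist (f p.1.1) (f p.1.2)
  have hsup : dist (f p') (f q') ≤ ⨆ p, g p :=
    le_ciSup (f := g) (Set.finite_range g).bddAbove ⟨(p', q'), h'⟩
  have hinf : ⨅ p, g p ≤ dist (f p) (f q) :=
    ciInf_le (f := g) (Set.finite_range g).bddBelow ⟨(p, q), h⟩
  have hpos : 0 < ⨅ p, g p := by
    obtain ⟨m, hm⟩ := exists_eq_ciInf_of_finite (f := g)
    rw [← hm]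
    exact dist_pos.2 (fun e => m.2 (hf e))
  change x ≤ (⨆ p, g p) / (⨅ p, g p)
  rw [le_div_iff₀ hpos]
  calc x * ⨅ p, g p ≤ x * dist (f p) (f q) := by gcongr
    _ ≤ _ := hd
    _ ≤ _ := hsup

end CactusRes

/-- There is a family of (binary) cactuses with arbitrarily many vertices and
maximum degree 4 whose strongly monotone drawings all have resolution at least
`c · 2^(n/44)`. -/
theorem stmt6 : ∃ c : ℝ, 0 < c ∧ ∀ N : ℕ,
    ∃ (V : Type) (_ : Fintype V) (G : SimpleGraph V),
      IsCactus G ∧ (∀ v : V, (G.neighborSet v).ncard ≤ 4) ∧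
      N ≤ Fintype.card V ∧
      ∀ f : V → Pt, IsStronglyMonotoneDrawing G f →
        c * 2 ^ ((Fintype.card V : ℝ) / 44) ≤ resolution f := by
  refine ⟨1 / 8, by norm_num, fun N => ⟨CactusRes.Vx (N + 1), inferInstance, CactusRes.T (N + 1),
    CactusRes.cactus _, CactusRes.degree_le _, ?_, ?_⟩⟩
  · simp; omega
  · intro f hf
    obtain ⟨p, q, p', q', h, h', hd⟩ := CactusRes.main (by omega) hf
    have hx : (2:ℝ) ^ N / 2 ≤ resolution f := by
      refine CactusRes.le_resolution hf.1 h h' (by positivity) ?_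
      simp at hd
      linarith
    refine le_trans ?_ hx
    have hc : (Fintype.card (CactusRes.Vx (N + 1)) : ℝ) / 44 ≤ ((N + 2 : ℕ) : ℝ) := by
      simp
      rw [div_le_iff₀ (by norm_num)]
      have : (0:ℝ) ≤ N := by positivity
      nlinarith
    have := Real.rpow_le_rpow_of_exponent_le (x := 2) (by norm_num) hc
    rw [Real.rpow_natCast] at this
    have e : (2:ℝ) ^ (N + 2) = 4 * 2 ^ N := by ring
    linarith
end
end

section
/- There exist a constant c > 0 and, for every natural number N, a finite tree T (a connected acyclic simple graph) with n ≥ N vertices and maximum degree at most 3 such that every strongly monotone straight-line drawing of T has resolution at least c · 2^{n/22}. -/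
open Real EuclideanGeometry
open scoped RealInnerProductSpace

noncomputable section

/-- A monotone walk entering `S` crosses into `S` along an edge of positive inner product. -/
lemma walk_cross {V : Type*} {G : SimpleGraph V} (f : V → Pt) (S : Set V) (D : Pt)
    {s t : V} (w : G.Walk s t) :
    (∀ i : ℕ, i + 1 < w.support.length →
      0 < ⟪(w.support.map f).getD (i + 1) 0 - (w.support.map f).getD i 0, D⟫) →
    s ∉ S → t ∈ S → ∃ u v, G.Adj u v ∧ u ∉ S ∧ v ∈ S ∧ 0 < ⟪f v - f u, D⟫ := by
  induction w with
  | nil => intro _ h1 h2; exact absurd h2 h1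
  | @cons a b c h p ih =>
    intro hm h1 h2
    by_cases hb : b ∈ S
    · refine ⟨a, b, h, h1, hb, ?_⟩
      have := hm 0 (by simp)
      cases p <;> simpa using this
    · refine ih ?_ hb h2
      intro i hi
      have := hm (i + 1) (by simpa using hi)
      simpa using this

lemma inner_coord (x y : Pt) : ⟪x, y⟫ = x 0 * y 0 + x 1 * y 1 := by
  simp [PiLp.inner_apply, Fin.sum_univ_two]; ring

/-- Parent relation on the comb-like tree. -/
def PR (m : ℕ) (x y : Fin 17 × Fin m) : Prop :=
  (x.1.val = y.1.val ∧ 1 ≤ x.2.val ∧ y.2.val = 2 * (x.2.val / 2) - 1) ∨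
  (x.2.val = 0 ∧ y.2.val = 0 ∧ x.1.val = y.1.val + 1)

/-- The tree: 17 binary caterpillars attached to a path. -/
def TG (m : ℕ) : SimpleGraph (Fin 17 × Fin m) where
  Adj x y := PR m x y ∨ PR m y x
  symm := ⟨fun _ _ h => h.symm⟩
  loopless := ⟨fun x h => by unfold PR at h; omega⟩

/-- The parent of a vertex. -/
def par (m : ℕ) (x : Fin 17 × Fin m) : Fin 17 × Fin m :=
  if x.2.val = 0 then (⟨x.1.val - 1, by omega⟩, x.2)
  else (x.1, ⟨2 * (x.2.val / 2) - 1, by omega⟩)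

lemma PR_par {m : ℕ} {x y : Fin 17 × Fin m} (h : PR m x y) : y = par m x := by
  obtain ⟨⟨x1, hx1⟩, ⟨x2, hx2⟩⟩ := x
  obtain ⟨⟨y1, hy1⟩, ⟨y2, hy2⟩⟩ := y
  unfold PR at h; unfold par
  simp only at h
  split_ifs with h0 <;> simp only [Prod.mk.injEq, Fin.mk.injEq] <;> simp only at h0 <;> omega

lemma par_PR {m : ℕ} {x : Fin 17 × Fin m} (h : x.1.val ≠ 0 ∨ x.2.val ≠ 0) :
    PR m x (par m x) := by
  obtain ⟨⟨x1, hx1⟩, ⟨x2, hx2⟩⟩ := x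
  unfold PR; unfold par
  simp only at h
  split_ifs with h0
  · simp only at h0 ⊢; omega
  · simp only at h0
    exact Or.inl ⟨rfl, by simp only; omega, rfl⟩

lemma TG_conn (m : ℕ) (hm : 0 < m) : (TG m).Connected := by
  have key : ∀ N : ℕ, ∀ x : Fin 17 × Fin m, x.1.val + x.2.val = N →
      (TG m).Reachable x (⟨0, by omega⟩, ⟨0, hm⟩) := by
    intro N
    induction N using Nat.strong_induction_on with
    | _ N ih =>
      intro x hx
      by_cases h : x.1.val ≠ 0 ∨ x.2.val ≠ 0
      · have h1 := par_PR h
        have h2 : (TG m).Adj x (par m x) := Or.inl h1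
        refine h2.reachable.trans (ih _ ?_ _ rfl)
        unfold PR at h1; omega
      · have : x = (⟨0, by omega⟩, ⟨0, hm⟩) := by
          obtain ⟨⟨x1, hx1⟩, ⟨x2, hx2⟩⟩ := x
          simp only [Prod.mk.injEq, Fin.mk.injEq] at h ⊢; omega
        rw [this]
  have : Nonempty (Fin 17 × Fin m) := ⟨(⟨0, by omega⟩, ⟨0, hm⟩)⟩
  exact ⟨fun x y => (key _ x rfl).trans (key _ y rfl).symm⟩

lemma TG_tree (m : ℕ) (hm : 0 < m) : (TG m).IsTree := by
  classical
  rw [SimpleGraph.isTree_iff_connected_and_card]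
  refine ⟨TG_conn m hm, ?_⟩
  have h1 := (TG_conn m hm).card_vert_le_card_edgeSet_add_one
  refine le_antisymm ?_ h1
  let r : Fin 17 × Fin m := (⟨0, by omega⟩, ⟨0, hm⟩)
  have hsub : (TG m).edgeSet ⊆ ((Finset.univ.erase r).image (fun x => s(x, par m x)) :
      Finset (Sym2 (Fin 17 × Fin m))) := by
    intro e
    induction e using Sym2.ind with
    | _ x y =>
      intro h
      have hr : ∀ x y, PR m x y → x ≠ r := by
        intro x y h hx
        subst hx
        simp only [PR, r] at h; omega
      simp only [Finset.coe_image, Set.mem_image, Finset.mem_coe, Finset.mem_erase,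
        Finset.mem_univ, and_true]
      have h' : PR m x y ∨ PR m y x := h
      rcases h' with h | h
      · exact ⟨x, hr _ _ h, by rw [← PR_par h]⟩
      · exact ⟨y, hr _ _ h, by rw [← PR_par h, Sym2.eq_swap]⟩
  have h2 := Nat.card_mono (Finset.finite_toSet _) hsub
  have h3 : Nat.card ((((Finset.univ.erase r).image (fun x => s(x, par m x)) :
      Finset (Sym2 (Fin 17 × Fin m)))) : Set (Sym2 (Fin 17 × Fin m))) ≤ (Finset.univ.erase r).card := by
    rw [Nat.card_coe_set_eq, Set.ncard_coe_finset]
    exact Finset.card_image_le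
  have h4 : (Finset.univ.erase r).card + 1 = Nat.card (Fin 17 × Fin m) := by
    rw [Finset.card_erase_add_one (Finset.mem_univ r), Nat.card_eq_fintype_card]; rfl
  omega

set_option maxHeartbeats 2000000 in
lemma TG_deg (m : ℕ) (v : Fin 17 × Fin m) : ((TG m).neighborSet v).ncard ≤ 3 := by
  classical
  let g : Fin 17 × Fin m → ℕ := fun y => 
    if PR m v y then 0 else if y.2.val = 0 then 1 else 1 + y.2.val % 2 
  have hg : ∀ y ∈ (TG m).neighborSet v, g y ∈ ((Finset.range 3 : Finset ℕ) : Set ℕ) := by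
    intro y _
    simp only [g, Finset.coe_range, Set.mem_Iio]
    split_ifs <;> omega
  have hinj : Set.InjOn g ((TG m).neighborSet v) := by
    intro y hy z hz hyz
    have hy' : PR m v y ∨ PR m y v := hy
    have hz' : PR m v z ∨ PR m z v := hz
    simp only [g] at hyz
    clear hy hz hg g
    have hyz' : y.1.val = z.1.val ∧ y.2.val = z.2.val := by
      by_cases A : PR m v y <;> by_cases B : PR m v z <;> by_cases C : y.2.val = 0 <;>
        by_cases D : z.2.val = 0 <;> simp only [A, B, C, D, if_true, if_false] at hyz <;>
        unfold PR at A B hy' hz' <;> omega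
    exact Prod.ext (Fin.ext hyz'.1) (Fin.ext hyz'.2)
  have := Set.ncard_le_ncard_of_injOn g hg hinj (Finset.finite_toSet _)
  rw [Set.ncard_coe_finset] at this
  simpa using this

/-- Separation: the direction of each edge separates the subtree below it from the rest. -/
lemma sep {m : ℕ} {f : Fin 17 × Fin m → Pt} (hf : IsStronglyMonotoneDrawing (TG m) f)
    (S : Set (Fin 17 × Fin m)) (u v : Fin 17 × Fin m)
    (hS : ∀ a b, (TG m).Adj a b → a ∉ S → b ∈ S → a = u ∧ b = v)
    (a b : Fin 17 × Fin m) (ha : a ∉ S) (hb : b ∈ S) :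
    0 < ⟪f v - f u, f b - f a⟫ := by
  have hab : a ≠ b := by rintro rfl; exact ha hb
  obtain ⟨w, -, hw⟩ := hf.2 a b hab
  obtain ⟨p, q, hpq, hp, hq, h⟩ := walk_cross f S _ w hw ha hb
  obtain ⟨rfl, rfl⟩ := hS p q hpq hp hq
  exact h

/-- Separation in index form. -/
lemma sep' {m : ℕ} {f : Fin 17 × Fin m → Pt} (hf : IsStronglyMonotoneDrawing (TG m) f)
    (j : Fin 17) (t p : Fin m) (ht : 1 ≤ t.val) (hp : p.val = 2 * (t.val / 2) - 1)
    (b : Fin 17 × Fin m) (s : Fin m)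
    (hs : s = t ∨ (t.val % 2 = 1 ∧ t.val ≤ s.val))
    (hb : b.1 ≠ j ∨ b.2.val < t.val ∨ (t.val % 2 = 0 ∧ b.2 ≠ t)) :
    0 < ⟪f (j, t) - f (j, p), f (j, s) - f b⟫ := by
  refine sep hf {x | x.1 = j ∧ (x.2 = t ∨ (t.val % 2 = 1 ∧ t.val ≤ x.2.val))} (j, p) (j, t) ?_ b
    (j, s) ?_ ⟨rfl, hs⟩
  · intro x y hxy hx hy
    have hxy' : PR m x y ∨ PR m y x := hxy
    obtain ⟨x1, x2⟩ := x
    obtain ⟨y1, y2⟩ := y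
    simp only [Set.mem_ofPred_eq, PR, Prod.mk.injEq, Fin.ext_iff] at *
    omega
  · obtain ⟨b1, b2⟩ := b
    simp only [Set.mem_ofPred_eq, Fin.ext_iff, ne_eq] at *
    omega

/-- The eight line directions. -/
def rx : Fin 8 → ℝ := ![1, 0, 1, 1, 5, 2, 5, 2]
def ry : Fin 8 → ℝ := ![0, 1, 1, -1, 2, 5, -2, -5]

set_option maxHeartbeats 2000000 in
/-- Vectors on the same side of all eight lines form a small angle. -/
lemma small_angle_aux (a b c d : ℝ)
    (h : ∀ i : Fin 8, 0 < (rx i * b - ry i * a) * (rx i * d - ry i * c)) :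
    2 * (a * d - b * c) ≤ a * c + b * d := by
  have h0 := h 0
  have h1 := h 1
  have h2 := h 2
  have h3 := h 3
  have h4 := h 4
  have h5 := h 5
  have h6 := h 6
  have h7 := h 7
  simp [rx, ry] at h0 h1 h2 h3 h4 h5 h6 h7
  rcases pos_and_pos_or_neg_and_neg_of_mul_pos h0 with ⟨b0, d0⟩ | ⟨b0, d0⟩ <;>
  rcases pos_and_pos_or_neg_and_neg_of_mul_pos h1 with ⟨a0, c0⟩ | ⟨a0, c0⟩ <;>
  rcases pos_and_pos_or_neg_and_neg_of_mul_pos h2 with ⟨p2, q2⟩ | ⟨p2, q2⟩ <;>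
  rcases pos_and_pos_or_neg_and_neg_of_mul_pos h3 with ⟨p3, q3⟩ | ⟨p3, q3⟩ <;>
  (try (exfalso; linarith)) <;>
  rcases pos_and_pos_or_neg_and_neg_of_mul_pos h4 with ⟨p4, q4⟩ | ⟨p4, q4⟩ <;>
  rcases pos_and_pos_or_neg_and_neg_of_mul_pos h5 with ⟨p5, q5⟩ | ⟨p5, q5⟩ <;>
  (try (exfalso; linarith)) <;>
  rcases pos_and_pos_or_neg_and_neg_of_mul_pos h6 with ⟨p6, q6⟩ | ⟨p6, q6⟩ <;>
  rcases pos_and_pos_or_neg_and_neg_of_mul_pos h7 with ⟨p7, q7⟩ | ⟨p7, q7⟩ <;>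
  (try (exfalso; linarith)) <;>
  clear h h0 h1 h2 h3 h4 h5 h6 h7 <;> first
  | nlinarith only [b0, d0, p4, q4]
  | nlinarith only [p4, q4, p2, q2]
  | nlinarith only [p2, q2, p5, q5]
  | nlinarith only [p5, q5, a0, c0]
  | nlinarith only [a0, c0, p7, q7]
  | nlinarith only [p7, q7, p3, q3]
  | nlinarith only [p3, q3, p6, q6]
  | nlinarith only [p6, q6, b0, d0]

lemma small_angle (a b c d : ℝ)
    (h : ∀ i : Fin 8, 0 < (rx i * b - ry i * a) * (rx i * d - ry i * c)) :
    0 < a * c + b * d ∧ 4 * (a * d - b * c) ^ 2 ≤ (a * c + b * d) ^ 2 := by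
  have h1 := small_angle_aux a b c d h
  have h2 := small_angle_aux c d a b (fun i => by rw [mul_comm]; exact h i)
  have h3 := h 0
  have h4 := h 1
  simp [rx, ry] at h3 h4
  constructor
  · linarith
  · nlinarith

/-- The contraction step. -/
lemma contract (u1 u2 v1 v2 z1 z2 : ℝ)
    (huv : 0 < u1 * v1 + u2 * v2 ∧ 4 * (u1 * v2 - u2 * v1) ^ 2 ≤ (u1 * v1 + u2 * v2) ^ 2)
    (hvz : 0 < v1 * z1 + v2 * z2 ∧ 4 * (v1 * z2 - v2 * z1) ^ 2 ≤ (v1 * z1 + v2 * z2) ^ 2)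
    (h1 : 0 < u1 * (u1 - v1) + u2 * (u2 - v2))
    (h3 : 0 < v1 * (v1 - u1 - z1) + v2 * (v2 - u2 - z2)) :
    16 * (z1 ^ 2 + z2 ^ 2) ≤ u1 ^ 2 + u2 ^ 2 := by
  obtain ⟨hp, hp2⟩ := huv
  obtain ⟨hr, hr2⟩ := hvz
  obtain ⟨p, hpd⟩ : ∃ p, p = u1 * v1 + u2 * v2 := ⟨_, rfl⟩
  obtain ⟨r, hrd⟩ : ∃ r, r = v1 * z1 + v2 * z2 := ⟨_, rfl⟩
  obtain ⟨U, hU⟩ : ∃ U, U = u1 ^ 2 + u2 ^ 2 := ⟨_, rfl⟩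
  obtain ⟨Q, hQ⟩ : ∃ Q, Q = v1 ^ 2 + v2 ^ 2 := ⟨_, rfl⟩
  obtain ⟨Z, hZ⟩ : ∃ Z, Z = z1 ^ 2 + z2 ^ 2 := ⟨_, rfl⟩
  have e1 : 4 * (U * Q) ≤ 5 * p ^ 2 := by
    have : U * Q = p ^ 2 + (u1 * v2 - u2 * v1) ^ 2 := by rw [hU, hQ, hpd]; ring
    rw [this, hpd]; linarith
  have e2 : 4 * (Q * Z) ≤ 5 * r ^ 2 := by
    have : Q * Z = r ^ 2 + (v1 * z2 - v2 * z1) ^ 2 := by rw [hQ, hZ, hrd]; ring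
    rw [this, hrd]; linarith
  have e3 : p < U := by rw [hpd, hU]; linarith
  have e4 : r < Q - p := by rw [hpd, hrd, hQ]; linarith
  rw [← hpd] at hp
  rw [← hrd] at hr
  rw [← hZ, ← hU]
  have hQ0 : 0 < Q := by linarith
  have hQp : 4 * Q ≤ 5 * p := by
    by_contra hc
    push Not at hc
    nlinarith
  have e5 : r ^ 2 ≤ (Q - p) ^ 2 := by nlinarith
  have e6 : 20 * (Q - p) ^ 2 ≤ p * Q := by
    nlinarith [mul_nonneg (sub_nonneg.2 hQp) (show (0:ℝ) ≤ 5 * Q - 4 * p by linarith)]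
  have e7 : p * Q ≤ U * Q := by nlinarith
  have e8 : (16 * Z) * Q ≤ U * Q := by nlinarith
  exact le_of_mul_le_mul_right e8 hQ0

/-- Signed rays. -/
def sg (b : Bool) : ℝ := if b then 1 else -1

theorem main_geo (k : ℕ) (f : Fin 17 × Fin (2 * k + 4) → Pt)
    (hf : IsStronglyMonotoneDrawing (TG (2 * k + 4)) f) :
    ∃ a b c d : Fin 17 × Fin (2 * k + 4), a ≠ b ∧ c ≠ d ∧
      4 ^ k * dist (f c) (f d) ≤ dist (f a) (f b) := by
  classical
  -- edge vectors in the arms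
  let P : Fin (2 * k + 4) → Fin (2 * k + 4) := fun t => ⟨2 * (t.val / 2) - 1, by omega⟩
  let z0 : Fin (2 * k + 4) := ⟨0, by omega⟩
  let o1 : Fin (2 * k + 4) := ⟨1, by omega⟩
  let E : Fin 17 → Fin (2 * k + 4) → Pt := fun j t => f (j, t) - f (j, P t)
  have hsep : ∀ (j : Fin 17) (t : Fin (2 * k + 4)), 1 ≤ t.val →
      ∀ (b : Fin 17 × Fin (2 * k + 4)) (s : Fin (2 * k + 4)),
      (s = t ∨ (t.val % 2 = 1 ∧ t.val ≤ s.val)) →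
      (b.1 ≠ j ∨ b.2.val < t.val ∨ (t.val % 2 = 0 ∧ b.2 ≠ t)) →
      0 < ⟪E j t, f (j, s) - f b⟫ := by
    intro j t ht b s hs hb
    exact sep' hf j t (P t) ht rfl b s hs hb
  let Hit : Fin 17 → Fin 8 × Bool → Prop := fun j r =>
    ∃ t : Fin (2 * k + 4), 1 ≤ t.val ∧ ∃ α β : ℝ, 0 ≤ α ∧ 0 ≤ β ∧ 0 < α + β ∧ ∃ γ : ℝ, 0 < γ ∧
      γ * (sg r.2 * rx r.1) = α * E j o1 0 + β * E j t 0 ∧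
      γ * (sg r.2 * ry r.1) = α * E j o1 1 + β * E j t 1
  have hitpos : ∀ α β γ A B R : ℝ, 0 ≤ α → 0 ≤ β → 0 < α + β → 0 < γ → 0 < A → 0 < B →
      γ * R = α * A + β * B → 0 < R := by
    intro α β γ A B R ha hb hab hg hA hB h
    have : 0 < γ * R := by
      rw [h]
      rcases ha.lt_or_eq with h' | h'
      · have := mul_pos h' hA
        have := mul_nonneg hb hB.le
        linarith
      · have h'' : 0 < β := by linarith
        have := mul_pos h'' hB
        have := mul_nonneg ha hA.le
        linarith
    exact (mul_pos_iff_of_pos_left hg).1 this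
  have hit_inj : ∀ i j r, Hit i r → Hit j r → i = j := by
    intro i j r hi hj
    by_contra hij
    obtain ⟨t, ht, α, β, hα, hβ, hαβ, γ, hγ, e1, e2⟩ := hi
    obtain ⟨t', ht', α', β', hα', hβ', hαβ', γ', hγ', e1', e2'⟩ := hj
    have q1 := hsep i o1 le_rfl (j, t') t (Or.inr ⟨rfl, ht⟩) (Or.inl (Ne.symm hij))
    have q2 := hsep i t ht (j, t') t (Or.inl rfl) (Or.inl (Ne.symm hij))
    have q3 := hsep j o1 le_rfl (i, t) t' (Or.inr ⟨rfl, ht'⟩) (Or.inl hij)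
    have q4 := hsep j t' ht' (i, t) t' (Or.inl rfl) (Or.inl hij)
    rw [inner_coord] at q1 q2 q3 q4
    have w0 : (f (j, t') - f (i, t)) 0 = - (f (i, t) - f (j, t')) 0 := by simp
    have w1 : (f (j, t') - f (i, t)) 1 = - (f (i, t) - f (j, t')) 1 := by simp
    rw [w0, w1] at q3 q4
    generalize (f (i, t) - f (j, t')) 0 = x at *
    generalize (f (i, t) - f (j, t')) 1 = y at *
    have r1 := hitpos α β γ _ _ (sg r.2 * rx r.1 * x + sg r.2 * ry r.1 * y) hα hβ hαβ hγ q1 q2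
      (by linear_combination x * e1 + y * e2)
    have r2 := hitpos α' β' γ' _ _ (-(sg r.2 * rx r.1 * x + sg r.2 * ry r.1 * y)) hα' hβ' hαβ' hγ'
      q3 q4 (by linear_combination - x * e1' - y * e2')
    linarith
  -- pigeonhole
  obtain ⟨j, hj⟩ : ∃ j, ∀ r, ¬ Hit j r := by
    by_contra hc
    push Not at hc
    choose g hg using hc
    have hinj : Function.Injective g := by
      intro a b hab
      exact hit_inj a b (g a) (hg a) (by rw [hab]; exact hg b)
    have := Fintype.card_le_of_injective g hinj
    simp at this
  -- all edges of arm j are on the same sides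
  have same : ∀ (i : Fin 8) (t : Fin (2 * k + 4)), 1 ≤ t.val →
      0 < (rx i * E j o1 1 - ry i * E j o1 0) * (rx i * E j t 1 - ry i * E j t 0) := by
    intro i t ht
    by_contra hneg
    push Not at hneg
    have q1 := hsep j o1 le_rfl (j, z0) t (Or.inr ⟨rfl, ht⟩) (Or.inr (Or.inl (by simp [z0, o1])))
    have q2 := hsep j t ht (j, z0) t (Or.inl rfl) (Or.inr (Or.inl (by simp only [z0]; omega)))
    rw [inner_coord] at q1 q2
    generalize (f (j, t) - f (j, z0)) 0 = x at *
    generalize (f (j, t) - f (j, z0)) 1 = y at *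
    have hno : ∀ (α β γ : ℝ), 0 ≤ α → 0 ≤ β → 0 < α + β → 
      γ * rx i = α * E j o1 0 + β * E j t 0 →
      γ * ry i = α * E j o1 1 + β * E j t 1 → False := by
      intro α β γ ha hb hab e1 e2
      rcases lt_trichotomy γ 0 with hg | hg | hg
      · refine hj (i, false) ⟨t, ht, α, β, ha, hb, hab, -γ, by linarith, ?_, ?_⟩
        · simp only [sg]; simp; linarith
        · simp only [sg]; simp; linarith
      · have := hitpos α β 1 _ _ 0 ha hb hab one_pos q1 q2
          (by subst hg; linear_combination x * e1 + y * e2)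
        exact lt_irrefl _ this
      · refine hj (i, true) ⟨t, ht, α, β, ha, hb, hab, γ, hg, ?_, ?_⟩
        · simp only [sg]; simp; linarith
        · simp only [sg]; simp; linarith
    generalize E j o1 0 = l0 at *
    generalize E j o1 1 = l1 at *
    generalize E j t 0 = d0 at *
    generalize E j t 1 = d1 at *
    have hr : 0 < rx i ^ 2 + ry i ^ 2 := by
      fin_cases i <;> norm_num [rx, ry]
    rcases lt_trichotomy (rx i * l1 - ry i * l0) 0 with hl | hl | hl
    · have hd : 0 ≤ rx i * d1 - ry i * d0 := by
        by_contra h'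
        push Not at h'
        have := mul_pos_of_neg_of_neg hl h'
        linarith
      exact hno (rx i * d1 - ry i * d0) (-(rx i * l1 - ry i * l0)) (l0 * d1 - l1 * d0) hd
        (by linarith) (by linarith) (by ring) (by ring)
    · refine hno 1 0 ((rx i * l0 + ry i * l1) / (rx i ^ 2 + ry i ^ 2)) zero_le_one le_rfl
        (by norm_num) ?_ ?_
      · field_simp
        linear_combination (ry i) * hl
      · field_simp
        linear_combination (-(rx i)) * hl
    · have hd : rx i * d1 - ry i * d0 ≤ 0 := by
        by_contra h'
        push Not at h'
        have := mul_pos hl h'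
        linarith
      exact hno (-(rx i * d1 - ry i * d0)) ((rx i * l1 - ry i * l0)) (-(l0 * d1 - l1 * d0))
        (by linarith)
        (by linarith) (by linarith) (by ring) (by ring)
  have ang : ∀ t t' : Fin (2 * k + 4), 1 ≤ t.val → 1 ≤ t'.val →
      0 < E j t 0 * E j t' 0 + E j t 1 * E j t' 1 ∧
      4 * (E j t 0 * E j t' 1 - E j t 1 * E j t' 0) ^ 2 ≤
        (E j t 0 * E j t' 0 + E j t 1 * E j t' 1) ^ 2 := by
    intro t t' ht ht'
    apply small_angle
    intro i
    have s1 := same i t ht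
    have s2 := same i t' ht'
    have := mul_pos s1 s2
    by_contra hc
    push Not at hc
    nlinarith [mul_nonneg (sq_nonneg (rx i * E j o1 1 - ry i * E j o1 0)) (neg_nonneg.2 hc)]
  -- spine
  let W : (i : ℕ) → i ≤ k + 1 → Pt := fun i hi => f (j, ⟨2 * i + 1, by omega⟩)
  have step : ∀ (i : ℕ) (hi : i + 2 ≤ k + 1),
      4 * dist (W (i + 2) hi) (W (i + 1) (by omega)) ≤
        dist (W (i + 1) (by omega)) (W i (by omega)) := by
    intro i hi
    let tb : Fin (2 * k + 4) := ⟨2 * (i + 1) + 1, by omega⟩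
    let tc : Fin (2 * k + 4) := ⟨2 * (i + 1), by omega⟩
    let td : Fin (2 * k + 4) := ⟨2 * (i + 2) + 1, by omega⟩
    let ta : Fin (2 * k + 4) := ⟨2 * i + 1, by omega⟩
    have pb : P tb = ta := by apply Fin.ext; simp only [P, tb, ta]; omega
    have pc : P tc = ta := by apply Fin.ext; simp only [P, tc, ta]; omega
    have pd : P td = tb := by apply Fin.ext; simp only [P, td, tb]; omega
    have a1 := ang tb tc (by simp only [tb]; omega) (by simp only [tc]; omega)
    have a2 := ang tc td (by simp only [tc]; omega) (by simp only [td]; omega)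
    have q1 := hsep j tb (by simp only [tb]; omega) (j, tc) tb (Or.inl rfl)
      (Or.inr (Or.inl (by simp only [tb, tc]; omega)))
    have q2 := hsep j tc (by simp only [tc]; omega) (j, td) tc (Or.inl rfl)
      (Or.inr (Or.inr ⟨by simp only [tc]; omega, by
        simp only [td, tc, ne_eq, Fin.ext_iff]; omega⟩))
    rw [inner_coord] at q1 q2
    simp only [E, pb, pc, pd, PiLp.sub_apply] at a1 a2 q1 q2
    have := contract _ _ _ _ _ _ a1 a2 (by linarith) (by linarith)
    show 4 * dist (f (j, td)) (f (j, tb)) ≤ dist (f (j, tb)) (f (j, ta))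
    rw [EuclideanSpace.dist_eq, EuclideanSpace.dist_eq, Fin.sum_univ_two, Fin.sum_univ_two]
    simp only [Real.dist_eq, sq_abs]
    apply Real.le_sqrt_of_sq_le
    rw [mul_pow, Real.sq_sqrt (by positivity)]
    linarith
  have iter : ∀ (i : ℕ) (hi : i + 1 ≤ k + 1),
      4 ^ i * dist (W (i + 1) hi) (W i (by omega)) ≤
        dist (W 1 (by omega)) (W 0 (by omega)) := by
    intro i
    induction i with
    | zero => intro hi; simp
    | succ i ih =>
      intro hi
      have h1 := ih (by omega)
      have h2 := step i hi
      have h3 := mul_le_mul_of_nonneg_left h2 (show (0:ℝ) ≤ 4 ^ i by positivity)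
      rw [pow_succ]
      linarith
  refine ⟨_, _, _, _, ?_, ?_, iter k le_rfl⟩
  · simp
  · simp

lemma res_le {V : Type*} [Fintype V] (f : V → Pt) (hf : Function.Injective f) (K : ℝ)
    (a b c d : V) (hab : a ≠ b) (hcd : c ≠ d)
    (h : K * dist (f c) (f d) ≤ dist (f a) (f b)) : K ≤ resolution f := by
  unfold resolution
  have : Nonempty {p : V × V // p.1 ≠ p.2} := ⟨⟨(a, b), hab⟩⟩
  have h1 : dist (f a) (f b) ≤ ⨆ p : {p : V × V // p.1 ≠ p.2}, dist (f p.1.1) (f p.1.2) :=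
    le_ciSup (f := fun p : {p : V × V // p.1 ≠ p.2} => dist (f p.1.1) (f p.1.2))
      (Set.finite_range _).bddAbove ⟨(a, b), hab⟩
  have h2 : ⨅ p : {p : V × V // p.1 ≠ p.2}, dist (f p.1.1) (f p.1.2) ≤ dist (f c) (f d) :=
    ciInf_le (f := fun p : {p : V × V // p.1 ≠ p.2} => dist (f p.1.1) (f p.1.2))
      (Set.finite_range _).bddBelow ⟨(c, d), hcd⟩
  have h3 : 0 < ⨅ p : {p : V × V // p.1 ≠ p.2}, dist (f p.1.1) (f p.1.2) := by
    obtain ⟨q, hq⟩ := exists_eq_ciInf_of_finite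
      (f := fun p : {p : V × V // p.1 ≠ p.2} => dist (f p.1.1) (f p.1.2))
    rw [← hq]
    exact dist_pos.2 (fun e => q.2 (hf e))
  rw [le_div_iff₀ h3]
  rcases le_total 0 K with hK | hK
  · exact (mul_le_mul_of_nonneg_left h2 hK).trans (h.trans h1)
  · have : 0 ≤ dist (f a) (f b) := dist_nonneg
    nlinarith

/-- There is a family of trees with arbitrarily many vertices and maximum
degree 3 whose strongly monotone drawings all have resolution at least
`c · 2^(n/22)`. -/
theorem stmt7 : ∃ c : ℝ, 0 < c ∧ ∀ N : ℕ,
    ∃ (V : Type) (_ : Fintype V) (G : SimpleGraph V),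
      G.IsTree ∧ (∀ v : V, (G.neighborSet v).ncard ≤ 3) ∧
      N ≤ Fintype.card V ∧
      ∀ f : V → Pt, IsStronglyMonotoneDrawing G f →
        c * 2 ^ ((Fintype.card V : ℝ) / 22) ≤ resolution f := by
  refine ⟨1 / 16, by norm_num, fun N => ⟨Fin 17 × Fin (2 * N + 4), inferInstance, TG _,
    TG_tree _ (by omega), TG_deg _, ?_, ?_⟩⟩
  · simp; omega
  · intro f hf
    obtain ⟨a, b, c, d, hab, hcd, h⟩ := main_geo N f hf
    refine le_trans ?_ (res_le f hf.1 (4 ^ N) a b c d hab hcd h)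
    have e : (2:ℝ) ^ ((Fintype.card (Fin 17 × Fin (2 * N + 4)) : ℝ) / 22) ≤
        (2:ℝ) ^ ((2 * N + 4 : ℕ) : ℝ) := by
      apply Real.rpow_le_rpow_of_exponent_le (by norm_num)
      simp only [Fintype.card_prod, Fintype.card_fin]
      push_cast
      have : (0:ℝ) ≤ N := Nat.cast_nonneg N
      linarith
    rw [Real.rpow_natCast, pow_add, pow_mul] at e
    norm_num at e ⊢
    linarith
end
end
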